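/- arXiv:1409.0299 — 3 statements merged into one kernel-verified Lean document; each statement's English description precedes it below -/
import Mathlib

section
/- Let A ⊆ B be an extension of commutative rings and M an affine positive commutative cancellative torsion-free monoid. If A is subintegrally closed in B, then A[M] is subintegrally closed in B[M]. -/
open scoped Classical

noncomputable section

/-- `A` is subintegrally closed in its ambient ring `B`:
every `b : B` with `b² ∈ A` and `b³ ∈ A` lies in `A`. -/
def Subring.IsSubintegrallyClosedIn {B : Type*} [CommRing B] (A : Subring B) : Prop :=
  ∀ b : B, b ^ 2 ∈ A → b ^ 3 ∈ A → b ∈ A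

/-- `M` is subintegrally closed in its ambient monoid `N`:
every `x : N` with `x² ∈ M` and `x³ ∈ M` lies in `M`. -/
def Submonoid.IsSubintegrallyClosedIn {N : Type*} [CommMonoid N] (M : Submonoid N) : Prop :=
  ∀ x : N, x ^ 2 ∈ M → x ^ 3 ∈ M → x ∈ M

/-- A commutative monoid is torsion-free. -/
def MulTorsionFree (N : Type*) [CommMonoid N] : Prop :=
  ∀ (x y : N) (n : ℕ), n ≠ 0 → x ^ n = y ^ n → x = y

/-- A commutative monoid is positive if its only unit is the identity. -/
def IsPositiveMonoid (N : Type*) [CommMonoid N] : Prop :=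
  ∀ x : N, IsUnit x → x = 1

/-- The subring `A[M]` of the monoid algebra `B[N]`, for a subring `A ⊆ B` and a submonoid
`M ⊆ N`: the subring generated by the elements `a·m` (`a ∈ A`, `m ∈ M`); equivalently, the set
of elements of `B[N]` supported on `M` with all coefficients in `A`. -/
def monoidAlgebraSubring {B : Type*} [CommRing B] {N : Type*} [CommMonoid N]
    (A : Subring B) (M : Submonoid N) : Subring (MonoidAlgebra B N) :=
  Subring.closure {x | ∃ a ∈ A, ∃ m ∈ M, x = MonoidAlgebra.single m a}

theorem Subring.IsSubintegrallyClosedIn.mem_of_forall_pow_mem {B : Type*} [CommRing B]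
    {A : Subring B} (hA : A.IsSubintegrallyClosedIn) {x : B} (N : ℕ)
    (h : ∀ n, N ≤ n → x ^ n ∈ A) : x ∈ A := by
  have key : ∀ k, ∀ n, N - k ≤ n → 1 ≤ n → x ^ n ∈ A := by
    intro k
    induction k with
    | zero => exact fun n hn _ => h n (by omega)
    | succ k ih =>
      intro n hn hn1
      refine hA _ ?_ ?_
      · rw [← pow_mul]; exact ih _ (by omega) (by omega)
      · rw [← pow_mul]; exact ih _ (by omega) (by omega)
  simpa using key N 1 (by omega) le_rfl

open Polynomial in
theorem IsIntegral.exists_forall_mul_pow_mem {B : Type*} [CommRing B] {A : Subring B} {a y : B}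
    (ha : a ∈ A) (hy : IsIntegral A y) (k : ℕ) (h : a ^ k * y ∈ A) :
    ∃ K, ∀ n, a ^ K * y ^ n ∈ A := by
  obtain ⟨p, hp, hpy⟩ := hy
  refine ⟨k * p.natDegree, fun n => ?_⟩
  have hmod : y ^ n = aeval y (X ^ n %ₘ p) := by
    have := congrArg (aeval y) (modByMonic_add_div (X ^ n) p)
    rw [map_add, map_mul, aeval_def y p, hpy, zero_mul, add_zero] at this
    rw [this, map_pow, aeval_X]
  rw [hmod, aeval_eq_sum_range, Finset.mul_sum]
  refine sum_mem fun i hi => ?_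
  have hi' : i ≤ p.natDegree := by
    have := natDegree_modByMonic_le (X ^ n) hp
    have := Finset.mem_range.1 hi
    omega
  have : a ^ (k * p.natDegree) * ((X ^ n %ₘ p).coeff i • y ^ i) =
      ((X ^ n %ₘ p).coeff i : B) * (a ^ (k * (p.natDegree - i)) * (a ^ k * y) ^ i) := by
    rw [mul_pow, ← pow_mul, Subring.smul_def, smul_eq_mul]
    have : k * p.natDegree = k * (p.natDegree - i) + k * i := by
      rw [← mul_add, Nat.sub_add_cancel hi']
    rw [this, pow_add]; ring
  rw [this]
  exact A.mul_mem (SetLike.coe_mem _) (A.mul_mem (A.pow_mem ha _) (A.pow_mem h _))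

theorem Subring.IsSubintegrallyClosedIn.mul_mem_of_pow_mul_mem {B : Type*} [CommRing B]
    {A : Subring B} (hA : A.IsSubintegrallyClosedIn) {a y : B} (ha : a ∈ A)
    (hy : IsIntegral A y) {k : ℕ} (h : a ^ k * y ∈ A) : a * y ∈ A := by
  obtain ⟨K, hK⟩ := hy.exists_forall_mul_pow_mem ha k h
  refine hA.mem_of_forall_pow_mem K fun n hn => ?_
  rw [mul_pow, ← Nat.sub_add_cancel hn, pow_add, mul_assoc, Nat.sub_add_cancel hn]
  exact A.mul_mem (A.pow_mem ha _) (hK n)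

open Polynomial in
/-- If the leading coefficient `b` of `f` lies in `A` and `f²`, `f³` have coefficients in `A`,
then comparing coefficients in `f * f² = f³` puts a multiple of each coefficient of `f` by a power
of `b` in `A`. -/
theorem Polynomial.leadingCoeff_pow_mul_coeff_mem {B : Type*} [CommRing B] {A : Subring B}
    {f : B[X]} (hb : f.leadingCoeff ∈ A) (h2 : ∀ n, (f ^ 2).coeff n ∈ A)
    (h3 : ∀ n, (f ^ 3).coeff n ∈ A) (j : ℕ) (hj : j ≤ f.natDegree) :
    f.leadingCoeff ^ (2 * j + 2) * f.coeff (f.natDegree - j) ∈ A := by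
  induction j using Nat.strong_induction_on with
  | _ j ih =>
  set d := f.natDegree with hd
  set b := f.leadingCoeff with hbdef
  have hc : (f ^ 3).coeff (3 * d - j) = ∑ x ∈ Finset.HasAntidiagonal.antidiagonal (3 * d - j),
      f.coeff x.1 * (f ^ 2).coeff x.2 := by
    rw [← coeff_mul]; congr 1; ring
  rw [← Finset.add_sum_erase _ _
    (show (d - j, 2 * d) ∈ Finset.HasAntidiagonal.antidiagonal (3 * d - j) by
      rw [Finset.HasAntidiagonal.mem_antidiagonal]; dsimp only; omega)] at hc
  dsimp only at hc
  rw [coeff_pow_mul_natDegree] at hc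
  have : b ^ (2 * j + 2) * f.coeff (d - j) = b ^ (2 * j) * (f ^ 3).coeff (3 * d - j) -
      ∑ x ∈ (Finset.HasAntidiagonal.antidiagonal (3 * d - j)).erase (d - j, 2 * d),
        b ^ (2 * j) * f.coeff x.1 * (f ^ 2).coeff x.2 := by
    rw [hc]
    simp_rw [mul_assoc]
    rw [← Finset.mul_sum]; ring
  rw [this]
  refine A.sub_mem (A.mul_mem (A.pow_mem hb _) (h3 _)) (sum_mem fun x hx => ?_)
  obtain ⟨x, y⟩ := x
  simp only [Finset.mem_erase, Finset.HasAntidiagonal.mem_antidiagonal, ne_eq, Prod.mk.injEq] at hx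
  dsimp only
  by_cases hxd : d < x
  · rw [coeff_eq_zero_of_natDegree_lt hxd]; simp
  by_cases hyd : 2 * d < y
  · rw [coeff_eq_zero_of_natDegree_lt (natDegree_pow_le.trans_lt hyd)]; simp
  refine A.mul_mem ?_ (h2 _)
  have hlt : d - x < j := by omega
  have := ih (d - x) hlt (by omega)
  rw [show d - (d - x) = x by omega] at this
  rw [show 2 * j = (2 * j - (2 * (d - x) + 2)) + (2 * (d - x) + 2) by omega, pow_add, mul_assoc]
  exact A.mul_mem (A.pow_mem hb _) this

open Polynomial in
theorem Polynomial.isIntegral_coeff_of_coeff_sq_mem {B : Type*} [CommRing B] {A : Subring B}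
    {f : B[X]} (h2 : ∀ n, (f ^ 2).coeff n ∈ A) (n : ℕ) : IsIntegral A (f.coeff n) := by
  let := Polynomial.algebra A B
  refine IsIntegral.coeff (R := A) (S := B) ?_ n
  refine IsIntegral.of_pow (n := 2) two_pos ?_
  obtain ⟨g, hg⟩ := (mem_lifts (f := A.subtype) (f ^ 2)).1
    ((lifts_iff_coeff_lifts _).2 fun n => ⟨⟨_, h2 n⟩, rfl⟩)
  rw [← hg]
  exact isIntegral_algebraMap (R := A[X]) (x := g)

open Polynomial in
/-- The polynomial case: subintegral closedness passes to coefficients of polynomials. -/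
theorem Subring.IsSubintegrallyClosedIn.coeff_mem {B : Type*} [CommRing B] {A : Subring B}
    (hA : A.IsSubintegrallyClosedIn) (f : B[X]) (h2 : ∀ n, (f ^ 2).coeff n ∈ A)
    (h3 : ∀ n, (f ^ 3).coeff n ∈ A) : ∀ n, f.coeff n ∈ A := by
  induction hN : f.support.card using Nat.strong_induction_on generalizing f with
  | _ N ih =>
  by_cases hf : f = 0
  · simp [hf]
  have hb : f.leadingCoeff ∈ A :=
    hA _ (by rw [← coeff_pow_mul_natDegree]; exact h2 _)
      (by rw [← coeff_pow_mul_natDegree]; exact h3 _)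
  have hmul : ∀ n, f.leadingCoeff * f.coeff n ∈ A := fun n => by
    by_cases hn : n ≤ f.natDegree
    · refine hA.mul_mem_of_pow_mul_mem hb (isIntegral_coeff_of_coeff_sq_mem h2 n)
        (k := 2 * (f.natDegree - n) + 2) ?_
      have := leadingCoeff_pow_mul_coeff_mem hb h2 h3 (f.natDegree - n) (by omega)
      rwa [Nat.sub_sub_self hn] at this
    · rw [coeff_eq_zero_of_natDegree_lt (by omega)]; simp
  let S : Subring B[X] := (mapRingHom A.subtype).range
  have hS : ∀ p : B[X], p ∈ S ↔ ∀ n, p.coeff n ∈ A := fun p => by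
    rw [mem_map_range]; simp
  set t : B[X] := monomial f.natDegree f.leadingCoeff with ht
  have htS : t ∈ S := (hS _).2 fun n => by
    rw [ht, coeff_monomial]; split_ifs; exacts [hb, A.zero_mem]
  have htf : t * f ∈ S := (hS _).2 fun n => by
    rw [ht, ← C_mul_X_pow_eq_monomial, mul_assoc, coeff_C_mul, coeff_X_pow_mul']
    split_ifs
    · exact hmul _
    · simp
  have hfe : f.eraseLead = f - t := (eq_sub_of_add_eq f.eraseLead_add_monomial_natDegree_leadingCoeff)
  have he := ih _ (hN ▸ eraseLead_support_card_lt hf) f.eraseLead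
    ((hS _).1 (by
      rw [hfe, show (f - t) ^ 2 = f ^ 2 - (t * f + t * f) + t ^ 2 by ring]
      exact S.add_mem (S.sub_mem ((hS _).2 h2) (S.add_mem htf htf)) (S.pow_mem htS 2)))
    ((hS _).1 (by
      rw [hfe, show (f - t) ^ 3 = f ^ 3 - 3 * (t * f ^ 2) + 3 * (t * (t * f)) - t ^ 3 by ring]
      have h3S : (3 : B[X]) ∈ S := ofNat_mem S 3
      exact S.sub_mem (S.add_mem (S.sub_mem ((hS _).2 h3)
        (S.mul_mem h3S (S.mul_mem htS ((hS _).2 h2))))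
        (S.mul_mem h3S (S.mul_mem htS htf))) (S.pow_mem htS 3))) rfl
  rw [← hS, ← f.eraseLead_add_monomial_natDegree_leadingCoeff]
  exact S.add_mem ((hS _).2 he) htS

open Polynomial in
/-- Finitely many points of a finite free `ℤ`-module are separated by a homomorphism to `ℤ`. -/
theorem AddCommGroup.exists_addMonoidHom_int_injOn {G : Type*} [AddCommGroup G] [Module.Free ℤ G]
    [Module.Finite ℤ G] (s : Finset G) : ∃ φ : G →+ ℤ, Set.InjOn φ s := by
  let e : G →+ ℤ[X] := (ofFn (Module.finrank ℤ G) ∘ₗ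
    (Module.finBasis ℤ G).equivFun.toLinearMap).toAddMonoidHom
  have he : Function.Injective e := by
    have h1 : Function.Injective (ofFn (R := ℤ) (Module.finrank ℤ G)) := by
      intro v w h
      rw [← LinearMap.id_apply (R := ℤ) v, ← LinearMap.id_apply (R := ℤ) w]
      rw [← toFn_comp_ofFn_eq_id _ v, h, toFn_comp_ofFn_eq_id]
    exact h1.comp (Module.finBasis ℤ G).equivFun.injective
  let P : ℤ[X] := ∏ x ∈ s.offDiag, (e x.1 - e x.2)
  have hP : P ≠ 0 := Finset.prod_ne_zero_iff.2 fun x hx =>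
    sub_ne_zero.2 fun h => (Finset.mem_offDiag.1 hx).2.2 (he h)
  obtain ⟨k, hk⟩ : ∃ k, P.eval k ≠ 0 := by
    by_contra! h
    exact hP (Polynomial.funext (by simpa using h))
  refine ⟨(evalRingHom k).toAddMonoidHom.comp e, fun x hx y hy hxy => ?_⟩
  by_contra hne
  refine hk ?_
  rw [eval_prod]
  refine Finset.prod_eq_zero (i := (x, y)) (Finset.mem_offDiag.2 ⟨hx, hy, hne⟩) ?_
  rw [eval_sub, sub_eq_zero]
  exact hxy

/-- Finitely many points of an affine monoid are separated by a homomorphism to `ℤ`. -/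
theorem exists_monoidHom_multiplicative_int_injOn {M : Type*} [CancelCommMonoid M]
    [IsMulTorsionFree M] [Monoid.FG M] (s : Finset M) :
    ∃ φ : M →* Multiplicative ℤ, Set.InjOn φ s := by
  let G := Algebra.GrothendieckGroup M
  let ι : M →* G := Algebra.GrothendieckGroup.of
  have hι : Function.Injective ι := Localization.mk_left_injective 1
  have : Group.FG G := Group.fg_iff_monoid_fg.2 inferInstance
  have : Module.Finite ℤ (Additive G) := Module.Finite.iff_addGroup_fg.2 inferInstance
  obtain ⟨ψ, hψ⟩ := AddCommGroup.exists_addMonoidHom_int_injOn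
    (s.image fun m => Additive.ofMul (ι m))
  refine ⟨(AddMonoidHom.toMultiplicativeRight ψ).comp ι, fun x hx y hy hxy => hι ?_⟩
  exact Additive.ofMul.injective (hψ (by simpa using ⟨x, hx, rfl⟩) (by simpa using ⟨y, hy, rfl⟩)
    (Multiplicative.ofAdd.injective hxy))

open LaurentPolynomial in
/-- A monoid homomorphism `M → ℤ` induces a map `B[M] → B[T;T⁻¹]` sending `A[M]` to Laurent
polynomials with coefficients in `A`. -/
theorem LaurentPolynomial.coeff_lift_mem {B : Type*} [CommRing B] {A : Subring B}
    {M : Type*} [CommMonoid M] (φ : M →* Multiplicative ℤ) {g : MonoidAlgebra B M}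
    (hg : g ∈ monoidAlgebraSubring A (⊤ : Submonoid M)) (i : ℤ) :
    (MonoidAlgebra.lift B B[T;T⁻¹] M ((AddMonoidAlgebra.of B ℤ).comp φ) g).coeff i ∈ A := by
  let Ψ := MonoidAlgebra.lift B B[T;T⁻¹] M ((AddMonoidAlgebra.of B ℤ).comp φ)
  let S : Subring B[T;T⁻¹] := (AddMonoidAlgebra.mapRingHom ℤ A.subtype).range
  have hle : monoidAlgebraSubring A (⊤ : Submonoid M) ≤ S.comap Ψ.toRingHom := by
    refine Subring.closure_le.2 ?_
    rintro _ ⟨a, ha, m, -, rfl⟩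
    refine ⟨AddMonoidAlgebra.single (φ m).toAdd ⟨a, ha⟩, ?_⟩
    simp [Ψ, -LaurentPolynomial.single_eq_C_mul_T]
  obtain ⟨h, hh⟩ := hle hg
  change (Ψ g).coeff i ∈ A
  rw [show Ψ g = _ from hh.symm, AddMonoidAlgebra.coeff_mapRingHom]
  exact SetLike.coe_mem _

theorem MonoidAlgebra.mem_monoidAlgebraSubring_top {B : Type*} [CommRing B] {A : Subring B}
    {M : Type*} [CommMonoid M] {f : MonoidAlgebra B M} (h : ∀ m, f.coeff m ∈ A) :
    f ∈ monoidAlgebraSubring A (⊤ : Submonoid M) := by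
  rw [← MonoidAlgebra.sum_coeff_single f]
  exact sum_mem fun m _ => Subring.subset_closure ⟨_, h m, m, trivial, rfl⟩

open LaurentPolynomial in
theorem LaurentPolynomial.coeff_lift_of_injOn {B : Type*} [CommRing B]
    {M : Type*} [CommMonoid M] (φ : M →* Multiplicative ℤ) (f : MonoidAlgebra B M)
    (hφ : Set.InjOn φ f.coeff.support) {m : M} (hm : m ∈ f.coeff.support) :
    (MonoidAlgebra.lift B B[T;T⁻¹] M ((AddMonoidAlgebra.of B ℤ).comp φ) f).coeff (φ m).toAdd =
      f.coeff m := by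
  rw [MonoidAlgebra.lift_apply, Finsupp.sum, AddMonoidAlgebra.coeff_sum, Finsupp.finsetSum_apply,
    Finset.sum_eq_single m]
  · simp
  · intro n hn hne
    have : φ n ≠ φ m := fun h => hne (hφ hn hm h)
    simp [this]
  · exact fun h => (h hm).elim

/-- **Sarwar, Lemma 3.2.**  Let `A ⊆ B` be an extension of commutative rings and `M` an
affine (finitely generated) positive commutative cancellative torsion-free monoid.  If `A` is
subintegrally closed in `B`, then `A[M]` is subintegrally closed in `B[M]`. -/
theorem monoidAlgebra_subintegrallyClosed_of_fg
    {B : Type*} [CommRing B] (A : Subring B)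
    {M : Type*} [CancelCommMonoid M]
    (htf : MulTorsionFree M) (hpos : IsPositiveMonoid M) (hfg : Monoid.FG M)
    (hA : A.IsSubintegrallyClosedIn) :
    (monoidAlgebraSubring A (⊤ : Submonoid M)).IsSubintegrallyClosedIn := by
  intro f h2 h3
  have : IsMulTorsionFree M := ⟨fun n hn x y h => htf x y n hn h⟩
  obtain ⟨φ, hφ⟩ := exists_monoidHom_multiplicative_int_injOn f.coeff.support
  let Ψ := MonoidAlgebra.lift B (LaurentPolynomial B) M ((AddMonoidAlgebra.of B ℤ).comp φ)
  obtain ⟨N, F, hF⟩ := LaurentPolynomial.exists_T_pow (Ψ f)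
  have hT : ∀ (g : LaurentPolynomial B) (n i : ℤ),
      (g * LaurentPolynomial.T n).coeff (i + n) = g.coeff i := fun g n i => by
    simp [LaurentPolynomial.T, -LaurentPolynomial.single_eq_C_mul_T]
  have hcoeff : ∀ (G : Polynomial B) (n : ℕ), (Polynomial.toLaurent G).coeff n = G.coeff n :=
    fun G n => by
      rw [LaurentPolynomial.coeff_toLaurent]
      exact Finsupp.mapDomain_apply Nat.castEmbedding.injective _ _
  have hpow : ∀ k : ℕ, f ^ k ∈ monoidAlgebraSubring A (⊤ : Submonoid M) →
      ∀ n, (F ^ k).coeff n ∈ A := fun k hk n => by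
    rw [← hcoeff, map_pow, hF, mul_pow, LaurentPolynomial.T_pow, ← map_pow,
      ← sub_add_cancel (n : ℤ) (k * N : ℤ), hT]
    exact LaurentPolynomial.coeff_lift_mem φ hk _
  have hFA := hA.coeff_mem F (hpow 2 h2) (hpow 3 h3)
  refine MonoidAlgebra.mem_monoidAlgebraSubring_top fun m => ?_
  by_cases hm : m ∈ f.coeff.support
  · rw [← LaurentPolynomial.coeff_lift_of_injOn φ f hφ hm, ← hT _ N]
    change (Ψ f * _).coeff _ ∈ A
    rw [← hF, LaurentPolynomial.coeff_toLaurent]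
    by_cases h : ∃ n : ℕ, (n : ℤ) = (φ m).toAdd + N
    · obtain ⟨n, hn⟩ := h
      rw [← hn, ← LaurentPolynomial.coeff_toLaurent, hcoeff]
      exact hFA n
    · rw [Finsupp.mapDomain_of_notMem_range _ _ (by simpa using h)]
      exact A.zero_mem
  · rw [Finsupp.notMem_support_iff.1 hm]
    exact A.zero_mem
end
end

section
/- Let A ⊆ B be an extension of reduced commutative rings such that A is subintegrally closed in B, and let m, n ≥ 0 be integers. Then the canonical group homomorphism 𝓘(A,B) → 𝓘(A[X₁,…,X_m], B[X₁,…,X_m,Y₁,…,Y_n]), sending an invertible A-submodule I of B to the A[X₁,…,X_m]-submodule of B[X₁,…,X_m,Y₁,…,Y_n] generated by I, is an isomorphism. -/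
open scoped Classical

noncomputable section

/-- The subring `A[X₁,…,X_m]` of `B[X₁,…,X_m,Y₁,…,Y_n]`: the range of the natural ring
homomorphism `A[X₁,…,X_m] → B[X₁,…,X_m,Y₁,…,Y_n]` (coefficientwise inclusion of `A` in `B`
followed by the renaming of the `m` variables into the first summand). -/
def polynomialSubringX {B : Type*} [CommRing B] (A : Subring B) (m n : ℕ) :
    Subring (MvPolynomial (Fin m ⊕ Fin n) B) :=
  (((MvPolynomial.rename (Sum.inl : Fin m → Fin m ⊕ Fin n)).toRingHom :
      MvPolynomial (Fin m) B →+* MvPolynomial (Fin m ⊕ Fin n) B).comp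
    (MvPolynomial.map (A.subtype) : MvPolynomial (Fin m) A →+* MvPolynomial (Fin m) B)).range

namespace Polynomial

theorem mem_liftsRing_iff_coeff {R S : Type*} [CommRing R] [CommRing S] {φ : R →+* S}
    {p : S[X]} : p ∈ liftsRing φ ↔ ∀ n, p.coeff n ∈ φ.range := by
  rw [← lifts_iff_liftsRing, lifts_iff_coeff_lifts]
  rfl

/-- Factors with constant coefficient `1` of a polynomial over `A` have integral coefficients. -/
theorem isIntegral_coeff_of_mul_mem_liftsRing_of_coeff_zero_eq_one {A B : Type*} [CommRing A]
    [CommRing B] [Algebra A B] {f g : B[X]} (hf : f.coeff 0 = 1) (hg : g.coeff 0 = 1)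
    (h : f * g ∈ liftsRing (algebraMap A B)) (n : ℕ) : IsIntegral A (f.coeff n) := by
  nontriviality B
  have monic_reflect (p : B[X]) (N : ℕ) (hp : p.coeff 0 = 1) (hN : p.natDegree ≤ N) :
      (p.reflect N).Monic := by
    refine monic_of_natDegree_le_of_coeff_eq_one N ?_ (by simp [revAt_le, hp])
    exact natDegree_reflect_le.trans (by simp [hN])
  have hmonic : (reflect (f.natDegree + g.natDegree) (f * g)).Monic :=
    monic_reflect _ _ (by simp [mul_coeff_zero, hf, hg]) natDegree_mul_le
  have hlift : reflect (f.natDegree + g.natDegree) (f * g) ∈ lifts (algebraMap A B) := by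
    rw [lifts_iff_liftsRing, mem_liftsRing_iff_coeff] at *
    intro n
    rw [coeff_reflect]
    exact h _
  obtain ⟨q, hq, -, hqm⟩ := lifts_and_degree_eq_and_monic hlift hmonic
  have := isIntegral_coeff_of_dvd q (reflect f.natDegree f) hqm (monic_reflect _ _ hf le_rfl)
    (by rw [hq, reflect_mul _ _ le_rfl le_rfl]; exact dvd_mul_right _ _) (revAt f.natDegree n)
  simpa using this

/-- Entries of a rank-one factorisation with integral products and constant coefficients are
integral. -/
theorem isIntegral_coeff_of_factorization {A B ι : Type*} [CommRing A] [CommRing B] [Algebra A B]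
    [Fintype ι] {f g : ι → B[X]} (hfg : ∀ i j, f i * g j ∈ liftsRing (algebraMap A B))
    (hsum : ∑ i, f i * g i = 1) (hf : ∀ i, (f i).coeff 0 ∈ (algebraMap A B).range)
    (hg : ∀ i, (g i).coeff 0 ∈ (algebraMap A B).range) (i : ι) (n : ℕ) :
    IsIntegral A ((f i).coeff n) := by
  have hsum0 : ∑ i, (f i).coeff 0 * (g i).coeff 0 = 1 := by
    simpa [finsetSum_coeff, mul_coeff_zero] using congrArg (fun p => coeff p 0) hsum
  have hC {b : B} (hb : b ∈ (algebraMap A B).range) : C b ∈ liftsRing (algebraMap A B) := by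
    rw [← lifts_iff_liftsRing]
    exact C'_mem_lifts hb
  set F : B[X] := ∑ j, C ((g j).coeff 0) * f j with hF
  set G : B[X] := ∑ j, C ((f j).coeff 0) * g j with hG
  have hF0 : F.coeff 0 = 1 := by
    simp only [hF, finsetSum_coeff, coeff_C_mul]
    rw [← hsum0]
    exact Finset.sum_congr rfl fun j _ => mul_comm _ _
  have hG0 : G.coeff 0 = 1 := by
    simp only [hG, finsetSum_coeff, coeff_C_mul]
    exact hsum0
  have hfG (i : ι) : f i * G ∈ liftsRing (algebraMap A B) := by
    rw [hG, Finset.mul_sum]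
    refine Subring.sum_mem _ fun j _ => ?_
    rw [mul_left_comm]
    exact Subring.mul_mem _ (hC (hf j)) (hfg i j)
  have hFG : F * G ∈ liftsRing (algebraMap A B) := by
    rw [hF, Finset.sum_mul]
    refine Subring.sum_mem _ fun j _ => ?_
    rw [mul_assoc]
    exact Subring.mul_mem _ (hC (hg j)) (hfG j)
  have hFint := isIntegral_coeff_of_mul_mem_liftsRing_of_coeff_zero_eq_one hF0 hG0 hFG
  have hc : IsIntegral A (1 - (f i).coeff 0) := by
    obtain ⟨a, ha⟩ := hf i
    exact isIntegral_one.sub (ha ▸ isIntegral_algebraMap)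
  have h1 := isIntegral_coeff_of_mul_mem_liftsRing_of_coeff_zero_eq_one
    (f := f i + C (1 - (f i).coeff 0) * F) (A := A) (by simp [hF0]) hG0
    (by
      rw [add_mul, mul_assoc]
      exact Subring.add_mem _ (hfG i) (Subring.mul_mem _
        (hC (Subring.sub_mem _ (Subring.one_mem _) (hf i))) hFG)) n
  have h2 := h1.sub (hc.mul (hFint n))
  rwa [coeff_add, coeff_C_mul, add_sub_cancel_right] at h2

/-- Over a field, a rank-one factorisation with entries in a reduced extension is defined over the
field as soon as its constant coefficients are. -/
theorem mem_liftsRing_of_factorization_of_field {k E ι : Type*} [Field k] [CommRing E]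
    [IsReduced E] [Fintype ι] (φ : k →+* E) {f g : ι → E[X]}
    (hfg : ∀ i j, f i * g j ∈ liftsRing φ) (hsum : ∑ i, f i * g i = 1)
    (hf : ∀ i, (f i).coeff 0 ∈ φ.range) (hg : ∀ i, (g i).coeff 0 ∈ φ.range) (i : ι) :
    f i ∈ liftsRing φ := by
  nontriviality E
  have hinj : Function.Injective (mapRingHom φ) := map_injective φ φ.injective
  have hsum0 : ∑ i, (f i).coeff 0 * (g i).coeff 0 = 1 := by
    simpa [finsetSum_coeff, mul_coeff_zero] using congrArg (fun p => coeff p 0) hsum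
  choose p hp using hfg
  choose a ha using hf
  choose b hb using hg
  have hab : ∑ i, a i * b i = 1 := φ.injective (by simpa [ha, hb] using hsum0)
  -- `P i` is the polynomial over `k` giving `f i * G`, where `G = ∑ j, f j (0) * g j`.
  set P : ι → k[X] := fun i => ∑ j, C (a j) * p i j with hP
  set G : E[X] := ∑ j, C (φ (a j)) * g j with hG
  have hPG (i : ι) : mapRingHom φ (P i) = f i * G := by
    simp only [hP, hG, map_sum, map_mul, Finset.mul_sum, hp]
    exact Finset.sum_congr rfl fun j _ => by simp [mul_left_comm]
  obtain ⟨d, hd⟩ := (IsPrincipalIdealRing.principal (Ideal.span (Set.range P))).principal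
  have hPd (i : ι) : ∃ s, P i = s * d := by
    have : P i ∈ Submodule.span k[X] {d} := hd ▸ Ideal.subset_span ⟨i, rfl⟩
    obtain ⟨s, hs⟩ := Submodule.mem_span_singleton.mp this
    exact ⟨s, hs.symm⟩
  choose s hs using hPd
  obtain ⟨r, hr⟩ : ∃ r : ι → k[X], ∑ i, r i * P i = d := by
    have : d ∈ Ideal.span (Set.range P) := by
      rw [hd]; exact Submodule.mem_span_singleton_self d
    exact (Ideal.mem_span_range_iff_exists_fun).mp this
  set u : E[X] := ∑ i, mapRingHom φ (r i) * f i with hu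
  have hud : u * G = mapRingHom φ d := by
    rw [hu, Finset.sum_mul, ← hr, map_sum]
    exact Finset.sum_congr rfl fun j _ => by rw [map_mul, hPG, mul_assoc]
  have hFG0 : ∑ i, C (b i) * P i ≠ 0 := by
    intro h
    have h1 := congrArg (fun q => (mapRingHom φ q).coeff 0) h
    simp only [map_sum, map_mul, hPG, finsetSum_coeff, mul_coeff_zero, map_zero, coeff_zero] at h1
    have hG0 : G.coeff 0 = 1 := by
      simp only [hG, finsetSum_coeff, coeff_C_mul, ha]
      exact hsum0
    simp only [hG0, mul_one, coe_mapRingHom, map_C, coeff_C_zero, ← ha, ← map_mul, ← map_sum] at h1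
    simp [mul_comm, hab] at h1
  have hfu (i : ι) : f i = mapRingHom φ (s i) * u := by
    have hG0 : (f i - mapRingHom φ (s i) * u) * G = 0 := by
      rw [sub_mul, mul_assoc, hud, ← hPG, hs, map_mul, sub_self]
    have hzero (j : ι) : (f i - mapRingHom φ (s i) * u) * g j = 0 := by
      have h1 : mapRingHom φ (p i j - s i * ∑ l, r l * p l j) =
          (f i - mapRingHom φ (s i) * u) * g j := by
        rw [map_sub, map_mul, map_sum, sub_mul, hp, hu, mul_assoc, Finset.sum_mul]
        simp only [map_mul, hp, mul_assoc]
      have h2 : (p i j - s i * ∑ l, r l * p l j) * ∑ i, C (b i) * P i = 0 := by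
        apply hinj
        rw [map_mul, h1, map_sum, map_zero, Finset.mul_sum]
        refine Finset.sum_eq_zero fun l _ => ?_
        rw [map_mul, hPG]
        linear_combination (g j * mapRingHom φ (C (b l)) * f l) * hG0
      rw [← h1, (mul_eq_zero.mp h2).resolve_right hFG0, map_zero]
    have : (f i - mapRingHom φ (s i) * u) * ∑ j, f j * g j = 0 := by
      rw [Finset.mul_sum]
      refine Finset.sum_eq_zero fun j _ => ?_
      linear_combination f j * hzero j
    rw [hsum, mul_one] at this
    exact sub_eq_zero.mp this
  have hunit : IsUnit u := by
    refine IsUnit.of_mul_eq_one (∑ i, mapRingHom φ (s i) * g i) ?_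
    rw [← hsum, Finset.mul_sum]
    refine Finset.sum_congr rfl fun j _ => ?_
    conv_rhs => rw [hfu j]
    ring
  obtain ⟨e, hue⟩ : ∃ e, u = C e := by
    refine ⟨u.coeff 0, ?_⟩
    have := (isUnit_iff_coeff_isUnit_isNilpotent.mp hunit).2
    ext n
    rcases eq_or_ne n 0 with rfl | hn
    · simp
    · rw [coeff_C_of_ne_zero hn]
      exact (this n hn).eq_zero
  have he : φ (∑ i, b i * (s i).coeff 0) * e = 1 := by
    rw [map_sum, Finset.sum_mul, ← hsum0]
    refine Finset.sum_congr rfl fun j _ => ?_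
    rw [hfu j, hue]
    simp [hb]
    ring
  have hne : (∑ i, b i * (s i).coeff 0) ≠ 0 := by
    intro h
    simp [h] at he
  have he' : e = φ (∑ i, b i * (s i).coeff 0)⁻¹ := by
    have h3 : φ (∑ i, b i * (s i).coeff 0)⁻¹ * φ (∑ i, b i * (s i).coeff 0) = 1 := by
      rw [← map_mul, inv_mul_cancel₀ hne, map_one]
    linear_combination (-e) * h3 + φ (∑ i, b i * (s i).coeff 0)⁻¹ * he
  refine ⟨s i * C (∑ i, b i * (s i).coeff 0)⁻¹, ?_⟩
  rw [map_mul, hfu i, hue, he']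
  simp

end Polynomial

/-- The conductor of `A` in `D`, the largest ideal of `D` contained in the image of `A`. -/
def algebraConductor (A D : Type*) [CommRing A] [CommRing D] [Algebra A D] : Ideal D where
  carrier := {x | ∀ y, x * y ∈ (algebraMap A D).range}
  add_mem' hx hx' y := by rw [add_mul]; exact Subring.add_mem _ (hx y) (hx' y)
  zero_mem' y := by rw [zero_mul]; exact Subring.zero_mem _
  smul_mem' d x hx y := by
    rw [smul_eq_mul, mul_comm d x, mul_assoc]
    exact hx _

theorem mem_algebraConductor {A D : Type*} [CommRing A] [CommRing D] [Algebra A D] {x : D} :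
    x ∈ algebraConductor A D ↔ ∀ y, x * y ∈ (algebraMap A D).range :=
  Iff.rfl

theorem algebraConductor_isRadical {A D : Type*} [CommRing A] [CommRing D] [Algebra A D]
    (hA : ∀ b : D, b ^ 2 ∈ (algebraMap A D).range → b ^ 3 ∈ (algebraMap A D).range →
      b ∈ (algebraMap A D).range) : (algebraConductor A D).IsRadical := by
  have hsq (x : D) (hx : x ^ 2 ∈ algebraConductor A D) : x ∈ algebraConductor A D := by
    intro y
    refine hA _ ?_ ?_
    · rw [mul_pow]
      exact hx _
    · rw [show (x * y) ^ 3 = x ^ 2 * (x * y ^ 3) by ring]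
      exact hx _
  have : IsReduced (D ⧸ algebraConductor A D) := by
    refine (isReduced_iff_pow_one_lt 2 one_lt_two).mpr fun x hx => ?_
    obtain ⟨x, rfl⟩ := Ideal.Quotient.mk_surjective x
    rw [← map_pow, Ideal.Quotient.eq_zero_iff_mem] at hx
    exact Ideal.Quotient.eq_zero_iff_mem.mpr (hsq x hx)
  exact (Ideal.isRadical_iff_quotient_reduced _).mpr this

/-- If every element of a finite extension has a multiple by an element of `M` lying in `A`, then
the conductor meets `M`. -/
theorem exists_algebraMap_mem_algebraConductor {A D : Type*} [CommRing A] [CommRing D]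
    [Algebra A D] [Module.Finite A D] (M : Submonoid A)
    (h : ∀ x : D, ∃ t ∈ M, t • x ∈ (algebraMap A D).range) :
    ∃ t ∈ M, algebraMap A D t ∈ algebraConductor A D := by
  obtain ⟨s, hs⟩ := Module.Finite.fg_top (R := A) (M := D)
  choose t htM ht using h
  refine ⟨∏ x ∈ s, t x, Submonoid.prod_mem _ fun x _ => htM x, fun y => ?_⟩
  have hy : y ∈ Submodule.span A (s : Set D) := hs ▸ Submodule.mem_top
  rw [← Algebra.smul_def]
  induction hy using Submodule.span_induction with
  | mem x hx =>
    rw [← Finset.prod_erase_mul s t hx, mul_smul, Algebra.smul_def]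
    exact Subring.mul_mem _ ⟨_, rfl⟩ (ht x)
  | zero => rw [smul_zero]; exact Subring.zero_mem _
  | add x y _ _ hx hy => rw [smul_add]; exact Subring.add_mem _ hx hy
  | smul a x _ hx =>
    rw [smul_comm, Algebra.smul_def]
    exact Subring.mul_mem _ ⟨_, rfl⟩ hx

namespace Polynomial

/-- A finite, subintegrally closed extension generated by the coefficients of a rank-one
factorisation over `A` is trivial. -/
theorem algebraMap_surjective_of_factorization {A D ι : Type*} [CommRing A] [CommRing D]
    [Algebra A D] [Module.Finite A D] [Fintype ι]
    (hA : ∀ b : D, b ^ 2 ∈ (algebraMap A D).range → b ^ 3 ∈ (algebraMap A D).range →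
      b ∈ (algebraMap A D).range)
    {f g : ι → D[X]} (hfg : ∀ i j, f i * g j ∈ liftsRing (algebraMap A D))
    (hsum : ∑ i, f i * g i = 1) (hf : ∀ i, (f i).coeff 0 ∈ (algebraMap A D).range)
    (hg : ∀ i, (g i).coeff 0 ∈ (algebraMap A D).range)
    (hD : Algebra.adjoin A (⋃ i, Set.range (f i).coeff ∪ Set.range (g i).coeff) = ⊤) :
    Function.Surjective (algebraMap A D) := by
  set c := algebraConductor A D
  set c₀ : Ideal A := c.comap (algebraMap A D) with hc₀
  by_cases htop : c₀ = ⊤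
  · intro x
    have : (1 : A) ∈ c₀ := htop ▸ Submodule.mem_top
    rw [hc₀, Ideal.mem_comap, map_one] at this
    simpa using this x
  exfalso
  obtain ⟨⟨p, hp⟩⟩ := Ideal.nonempty_minimalPrimes htop
  have hpp : p.IsPrime := hp.1.1
  have hred : IsReduced (D ⧸ c) :=
    (Ideal.isRadical_iff_quotient_reduced _).mp (algebraConductor_isRadical hA)
  set M : Submonoid (D ⧸ c) := p.primeCompl.map (algebraMap A (D ⧸ c))
  set E := Localization M
  have halg (a : A) : algebraMap A (D ⧸ c) a = Ideal.Quotient.mk c (algebraMap A D a) := rfl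
  have hE : Nontrivial E := by
    refine ⟨1, 0, fun h => ?_⟩
    rw [← map_one (algebraMap (D ⧸ c) E), IsLocalization.map_eq_zero_iff M] at h
    obtain ⟨⟨_, s, hs, rfl⟩, h⟩ := h
    have h' : Ideal.Quotient.mk c (algebraMap A D s) = 0 := by
      rw [← halg]
      simpa only [mul_one] using h
    have hsc : algebraMap A D s ∈ c := Ideal.Quotient.eq_zero_iff_mem.mp h'
    exact hs (hp.1.2 hsc)
  set ψ : D →+* E := (algebraMap (D ⧸ c) E).comp (Ideal.Quotient.mk c) with hψ
  have hunit (a : A) (ha : a ∉ p) : IsUnit (ψ (algebraMap A D a)) :=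
    IsLocalization.map_units E (⟨_, a, ha, rfl⟩ : M)
  have hker (a : A) (ha : a ∈ p) : ψ (algebraMap A D a) = 0 := by
    rw [← isNilpotent_iff_eq_zero, ← mem_nilradical, nilradical_eq_sInf, Ideal.mem_sInf]
    intro P hP
    have hP : P.IsPrime := hP
    have hle : P.comap (ψ.comp (algebraMap A D)) ≤ p := fun x hx => by
      by_contra hxp
      exact hP.ne_top (Ideal.eq_top_of_isUnit_mem _ hx (hunit x hxp))
    refine hp.2 ⟨Ideal.IsPrime.comap _, fun x hx => ?_⟩ hle ha
    have : Ideal.Quotient.mk c (algebraMap A D x) = 0 := Ideal.Quotient.eq_zero_iff_mem.mpr hx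
    simp [hψ, this]
  set θ : A ⧸ p →+* E := Ideal.Quotient.lift p (ψ.comp (algebraMap A D)) hker
  set φ : FractionRing (A ⧸ p) →+* E := IsLocalization.lift (M := nonZeroDivisors (A ⧸ p)) (g := θ)
    (fun y => by
      obtain ⟨y, hy⟩ := y
      obtain ⟨a, rfl⟩ := Ideal.Quotient.mk_surjective y
      refine hunit a fun ha => nonZeroDivisors.ne_zero hy ?_
      exact Ideal.Quotient.eq_zero_iff_mem.mpr ha) with hφ
  have hφa (a : A) : φ (algebraMap _ _ (Ideal.Quotient.mk p a)) = ψ (algebraMap A D a) := by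
    rw [hφ, IsLocalization.lift_eq]
    rfl
  have hψrange {x : D} (hx : x ∈ (algebraMap A D).range) : ψ x ∈ φ.range := by
    obtain ⟨a, rfl⟩ := hx
    exact ⟨_, hφa a⟩
  have hψlift {q : D[X]} (hq : q ∈ liftsRing (algebraMap A D)) : mapRingHom ψ q ∈ liftsRing φ := by
    rw [mem_liftsRing_iff_coeff] at *
    intro n
    rw [coe_mapRingHom, coeff_map]
    exact hψrange (hq n)
  have hback {x : D} (hx : ψ x ∈ φ.range) :
      ∃ t ∈ p.primeCompl, t • x ∈ (algebraMap A D).range := by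
    obtain ⟨z, hz⟩ := hx
    obtain ⟨a, s, hs, rfl⟩ := IsFractionRing.div_surjective (A := A ⧸ p) z
    obtain ⟨a, rfl⟩ := Ideal.Quotient.mk_surjective a
    obtain ⟨s, rfl⟩ := Ideal.Quotient.mk_surjective s
    have hsp : s ∉ p := fun h =>
      nonZeroDivisors.ne_zero hs (Ideal.Quotient.eq_zero_iff_mem.mpr h)
    have hne : algebraMap (A ⧸ p) (FractionRing (A ⧸ p)) (Ideal.Quotient.mk p s) ≠ 0 :=
      IsLocalization.to_map_ne_zero_of_mem_nonZeroDivisors _ le_rfl hs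
    have h1 : ψ (algebraMap A D s * x) = ψ (algebraMap A D a) := by
      rw [map_mul, ← hz, ← hφa, ← hφa, ← map_mul, mul_div_cancel₀ _ hne]
    have h2 : algebraMap (D ⧸ c) E (Ideal.Quotient.mk c (algebraMap A D s * x)) =
      algebraMap (D ⧸ c) E (Ideal.Quotient.mk c (algebraMap A D a)) := h1
    obtain ⟨⟨_, t, ht, rfl⟩, h3⟩ := (IsLocalization.eq_iff_exists M E).mp h2
    simp only [halg, ← map_mul] at h3
    rw [Ideal.Quotient.eq] at h3
    refine ⟨t * s, Submonoid.mul_mem _ ht hsp, ?_⟩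
    have h4 : algebraMap A D t * (algebraMap A D s * x) - algebraMap A D t * algebraMap A D a ∈
        (algebraMap A D).range := by simpa using h3 1
    have h5 := Subring.add_mem _ h4 ⟨t * a, map_mul _ _ _⟩
    rwa [sub_add_cancel, ← mul_assoc, ← map_mul, ← Algebra.smul_def] at h5
  have hcoeff {f g : ι → D[X]} (hfg : ∀ i j, f i * g j ∈ liftsRing (algebraMap A D))
      (hsum : ∑ i, f i * g i = 1) (hf : ∀ i, (f i).coeff 0 ∈ (algebraMap A D).range)
      (hg : ∀ i, (g i).coeff 0 ∈ (algebraMap A D).range) (i : ι) (n : ℕ) :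
      ψ ((f i).coeff n) ∈ φ.range := by
    have := mem_liftsRing_of_factorization_of_field φ (f := fun i => mapRingHom ψ (f i))
      (g := fun i => mapRingHom ψ (g i)) (fun i j => by rw [← map_mul]; exact hψlift (hfg i j))
      (by simpa using congrArg (mapRingHom ψ) hsum)
      (fun i => by rw [coe_mapRingHom, coeff_map]; exact hψrange (hf i))
      (fun i => by rw [coe_mapRingHom, coeff_map]; exact hψrange (hg i)) i
    rw [mem_liftsRing_iff_coeff] at this
    simpa using this n
  have hall (x : D) : ψ x ∈ φ.range := by
    have hx : x ∈ Algebra.adjoin A (⋃ i, Set.range (f i).coeff ∪ Set.range (g i).coeff) :=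
      hD ▸ Algebra.mem_top
    induction hx using Algebra.adjoin_induction with
    | mem x hx =>
      obtain ⟨i, ⟨n, rfl⟩ | ⟨n, rfl⟩⟩ := Set.mem_iUnion.mp hx
      · exact hcoeff hfg hsum hf hg i n
      · exact hcoeff (fun i j => mul_comm (f j) (g i) ▸ hfg j i)
          (by simpa only [mul_comm] using hsum) hg hf i n
    | algebraMap a => exact hψrange ⟨a, rfl⟩
    | add x y _ _ hx hy => rw [map_add]; exact Subring.add_mem _ hx hy
    | mul x y _ _ hx hy => rw [map_mul]; exact Subring.mul_mem _ hx hy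
  obtain ⟨t, htp, ht⟩ := exists_algebraMap_mem_algebraConductor p.primeCompl
    fun x => hback (hall x)
  exact htp (hp.1.2 ht)

/-- For `A` subintegrally closed in `B`, the entries of a rank-one factorisation with products over
`A` and constant coefficients in `A` are polynomials over `A`. -/
theorem mem_liftsRing_of_factorization {A B ι : Type*} [CommRing A] [CommRing B] [Algebra A B]
    [Fintype ι]
    (hA : ∀ b : B, b ^ 2 ∈ (algebraMap A B).range → b ^ 3 ∈ (algebraMap A B).range →
      b ∈ (algebraMap A B).range)
    {f g : ι → B[X]} (hfg : ∀ i j, f i * g j ∈ liftsRing (algebraMap A B))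
    (hsum : ∑ i, f i * g i = 1) (hf : ∀ i, (f i).coeff 0 ∈ (algebraMap A B).range)
    (hg : ∀ i, (g i).coeff 0 ∈ (algebraMap A B).range) (i : ι) :
    f i ∈ liftsRing (algebraMap A B) := by
  set s : Set B := ⋃ i, Set.range (f i).coeff ∪ Set.range (g i).coeff
  set D := Algebra.adjoin A s
  have hsfin : s.Finite := by
    have hfin (p : B[X]) : (Set.range p.coeff).Finite := by
      refine Set.Finite.subset ((Finset.finite_toSet p.coeffs).union (Set.finite_singleton 0)) ?_
      rintro _ ⟨n, rfl⟩
      by_cases h : p.coeff n = 0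
      · exact Or.inr h
      · exact Or.inl (coeff_mem_coeffs h)
    exact Set.finite_iUnion fun i => (hfin _).union (hfin _)
  have hsint : ∀ x ∈ s, IsIntegral A x := by
    intro x hx
    obtain ⟨i, ⟨n, rfl⟩ | ⟨n, rfl⟩⟩ := Set.mem_iUnion.mp hx
    · exact isIntegral_coeff_of_factorization hfg hsum hf hg i n
    · exact isIntegral_coeff_of_factorization (fun i j => mul_comm (f j) (g i) ▸ hfg j i)
        (by simpa only [mul_comm] using hsum) hg hf i n
  have hfin : Module.Finite A D := Module.Finite.iff_fg.mpr (fg_adjoin_of_finite hsfin hsint)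
  have hrange {x : D} : x ∈ (algebraMap A D).range ↔ (x : B) ∈ (algebraMap A B).range :=
    ⟨fun ⟨a, ha⟩ => ⟨a, ha ▸ rfl⟩, fun ⟨a, ha⟩ => ⟨a, Subtype.ext ha⟩⟩
  have hlift (p : B[X]) (hp : ∀ n, p.coeff n ∈ s) :
      ∃ q : D[X], mapRingHom (algebraMap D B) q = p := by
    refine (mem_lifts _).mp ((lifts_iff_coeff_lifts p).mpr fun n => ?_)
    exact ⟨⟨_, Algebra.subset_adjoin (hp n)⟩, rfl⟩
  choose f' hf' using fun i => hlift (f i) fun n =>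
    Set.mem_iUnion.mpr ⟨i, Or.inl ⟨n, rfl⟩⟩
  choose g' hg' using fun i => hlift (g i) fun n =>
    Set.mem_iUnion.mpr ⟨i, Or.inr ⟨n, rfl⟩⟩
  have hcf (i : ι) (n : ℕ) : (((f' i).coeff n : D) : B) = (f i).coeff n := by
    rw [← hf', coe_mapRingHom, coeff_map]; rfl
  have hcg (i : ι) (n : ℕ) : (((g' i).coeff n : D) : B) = (g i).coeff n := by
    rw [← hg', coe_mapRingHom, coeff_map]; rfl
  have hinj : Function.Injective (mapRingHom (algebraMap D B)) :=
    map_injective _ Subtype.val_injective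
  have hsurj : Function.Surjective (algebraMap A D) := by
    refine algebraMap_surjective_of_factorization (f := f') (g := g') (fun b h2 h3 => ?_)
      (fun i j => ?_) ?_ (fun i => ?_) (fun i => ?_) ?_
    · rw [hrange] at *
      exact hA _ h2 h3
    · have := hfg i j
      rw [mem_liftsRing_iff_coeff] at *
      intro n
      rw [hrange]
      convert this n
      rw [← hf', ← hg', ← map_mul, coe_mapRingHom, coeff_map]
      rfl
    · apply hinj
      simpa [hf', hg', -coe_mapRingHom] using hsum
    · rw [hrange, hcf]
      exact hf i
    · rw [hrange, hcg]
      exact hg i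
    · rw [eq_top_iff, ← Algebra.adjoin_adjoin_coe_preimage]
      refine Algebra.adjoin_mono fun x hx => ?_
      obtain ⟨i, ⟨n, hn⟩ | ⟨n, hn⟩⟩ := Set.mem_iUnion.mp (show (x : B) ∈ s from hx)
      · exact Set.mem_iUnion.mpr ⟨i, Or.inl ⟨n, Subtype.ext ((hcf i n).trans hn)⟩⟩
      · exact Set.mem_iUnion.mpr ⟨i, Or.inr ⟨n, Subtype.ext ((hcg i n).trans hn)⟩⟩
  rw [mem_liftsRing_iff_coeff]
  intro n
  rw [← hcf, ← hrange]
  exact hsurj _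

end Polynomial

namespace MvPolynomial

/-- The substitution `X i ↦ T ^ w i`. -/
def weightSubst {σ : Type*} (B : Type*) [CommRing B] (w : σ → ℕ) :
    MvPolynomial σ B →+* Polynomial B :=
  eval₂Hom Polynomial.C fun i => Polynomial.X ^ w i

theorem coeff_weightSubst {σ B : Type*} [CommRing B] (w : σ → ℕ) (p : MvPolynomial σ B) (n : ℕ) :
    (weightSubst B w p).coeff n =
      ∑ d ∈ p.support with Finsupp.weight w d = n, p.coeff d := by
  rw [weightSubst, coe_eval₂Hom, eval₂_eq, Polynomial.finsetSum_coeff, Finset.sum_filter]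
  refine Finset.sum_congr rfl fun d _ => ?_
  simp only [← pow_mul, Finset.prod_pow_eq_pow_sum, Polynomial.coeff_C_mul, Polynomial.coeff_X_pow,
    Finsupp.weight_apply, Finsupp.sum, smul_eq_mul, mul_comm (w _), mul_ite, mul_one, mul_zero,
    eq_comm]

theorem coeff_weightSubst_of_injOn {σ B : Type*} [CommRing B] (w : σ → ℕ) (p : MvPolynomial σ B)
    (hw : Set.InjOn (Finsupp.weight w) (p.support : Set (σ →₀ ℕ))) {d : σ →₀ ℕ}
    (hd : d ∈ p.support) :
    (weightSubst B w p).coeff (Finsupp.weight w d) = p.coeff d := by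
  rw [coeff_weightSubst]
  refine Finset.sum_eq_single_of_mem d (by simpa using hd) fun e he hne => ?_
  rw [Finset.mem_filter] at he
  exact absurd (hw he.1 hd he.2) hne

theorem coeff_zero_weightSubst {σ B : Type*} [CommRing B] {w : σ → ℕ} (hw : ∀ i, w i ≠ 0)
    (p : MvPolynomial σ B) : (weightSubst B w p).coeff 0 = constantCoeff p := by
  rw [Polynomial.coeff_zero_eq_eval_zero]
  induction p using MvPolynomial.induction_on with
  | C a => simp [weightSubst]
  | add p q hp hq => simp [hp, hq]
  | mul_X p i hp => simp [weightSubst, hw]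

theorem exists_weight_injOn {σ : Type*} [Finite σ] (s : Finset (σ →₀ ℕ)) :
    ∃ w : σ → ℕ, (∀ i, w i ≠ 0) ∧ Set.InjOn (Finsupp.weight w) (s : Set (σ →₀ ℕ)) := by
  obtain ⟨k, ⟨e⟩⟩ := Finite.exists_equiv_fin σ
  have : Fintype σ := Fintype.ofFinite σ
  set N := s.sup (fun d => ∑ i, d i) + 1
  have hlt {d : σ →₀ ℕ} (hd : d ∈ s) (i : σ) : d i < N :=
    Nat.lt_succ_of_le ((Finset.single_le_sum (fun _ _ => Nat.zero_le _) (Finset.mem_univ i)).trans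
      (Finset.le_sup (f := fun d : σ →₀ ℕ => ∑ i, d i) hd))
  refine ⟨fun i => N ^ (e i : ℕ), fun i => (pow_pos (Nat.succ_pos _) _).ne', ?_⟩
  intro c hc d hd hcd
  have hform {d : σ →₀ ℕ} (hd : d ∈ s) : Finsupp.weight (fun i => N ^ (e i : ℕ)) d =
      finFunctionFinEquiv fun j : Fin k => (⟨d (e.symm j), hlt hd _⟩ : Fin N) := by
    rw [finFunctionFinEquiv_apply, Finsupp.weight_apply, Finsupp.sum_fintype _ _ (by simp)]
    exact Fintype.sum_equiv e _ _ (by simp)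
  have h := hcd
  rw [hform hc, hform hd] at h
  have h' := finFunctionFinEquiv.injective (Fin.ext h)
  ext i
  simpa using congrArg Fin.val (congrFun h' (e i))

/-- The several-variable form of `Polynomial.mem_liftsRing_of_factorization`, obtained by Kronecker
substitution. -/
theorem coeff_mem_of_factorization {σ B ι : Type*} [Finite σ] [CommRing B] [Fintype ι]
    {A : Subring B} (hA : A.IsSubintegrallyClosedIn) {f g : ι → MvPolynomial σ B}
    (hfg : ∀ i j d, coeff d (f i * g j) ∈ A) (hsum : ∑ i, f i * g i = 1)
    (hf : ∀ i, constantCoeff (f i) ∈ A) (hg : ∀ i, constantCoeff (g i) ∈ A) (i : ι)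
    (d : σ →₀ ℕ) : coeff d (f i) ∈ A := by
  obtain ⟨w, hw0, hw⟩ := exists_weight_injOn (f i).support
  by_cases hd : d ∈ (f i).support
  swap
  · rw [notMem_support_iff.mp hd]
    exact A.zero_mem
  have hr {b : B} : b ∈ (algebraMap A B).range ↔ b ∈ A := by
    rw [show algebraMap A B = A.subtype from rfl, Subring.range_subtype]
  have := Polynomial.mem_liftsRing_of_factorization (A := A)
    (f := fun i => weightSubst B w (f i)) (g := fun i => weightSubst B w (g i))
    (fun b h2 h3 => by rw [hr] at *; exact hA b h2 h3)
    (fun i j => by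
      rw [← map_mul, Polynomial.mem_liftsRing_iff_coeff]
      intro n
      rw [hr, coeff_weightSubst]
      exact A.sum_mem fun d _ => hfg i j d)
    (by simpa using congrArg (weightSubst B w) hsum)
    (fun i => by rw [hr, coeff_zero_weightSubst hw0]; exact hf i)
    (fun i => by rw [hr, coeff_zero_weightSubst hw0]; exact hg i) i
  rw [Polynomial.mem_liftsRing_iff_coeff] at this
  rw [← coeff_weightSubst_of_injOn w (f i) hw hd, ← hr]
  exact this _

end MvPolynomial


namespace Submodule

/-- Extension of submodules along a ring homomorphism `φ : S → S'` carrying the subring `R` into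
the subring `R'`: the `R'`-submodule generated by the image. -/
def spanImage {S S' : Type*} [CommRing S] [CommRing S'] {R : Subring S} {R' : Subring S'}
    (φ : S →+* S') (hφ : R ≤ R'.comap φ) : Submodule R S →* Submodule R' S' where
  toFun J := span R' (φ '' J)
  map_one' := by
    refine le_antisymm (span_le.mpr ?_) (one_le.mpr (subset_span ⟨1, one_le.mp le_rfl, map_one φ⟩))
    rintro _ ⟨x, hx, rfl⟩
    obtain ⟨r, rfl⟩ := mem_one.mp hx
    exact mem_one.mpr ⟨⟨φ r, hφ r.2⟩, rfl⟩
  map_mul' J K := by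
    refine le_antisymm (span_le.mpr ?_) ?_
    · rintro _ ⟨x, hx, rfl⟩
      refine Submodule.mul_induction_on hx (fun a ha b hb => ?_) fun a b ha hb => ?_
      · rw [map_mul]
        exact mul_mem_mul (subset_span ⟨a, ha, rfl⟩) (subset_span ⟨b, hb, rfl⟩)
      · rw [map_add]
        exact add_mem ha hb
    · rw [span_mul_span]
      refine span_mono ?_
      rintro _ ⟨_, ⟨a, ha, rfl⟩, _, ⟨b, hb, rfl⟩, rfl⟩
      exact ⟨a * b, mul_mem_mul ha hb, map_mul φ a b⟩

theorem spanImage_apply {S S' : Type*} [CommRing S] [CommRing S'] {R : Subring S}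
    {R' : Subring S'} (φ : S →+* S') (hφ : R ≤ R'.comap φ) (J : Submodule R S) :
    spanImage φ hφ J = span R' (φ '' J) :=
  rfl

/-- Extension along a section followed by extension along the retraction is the identity. -/
theorem spanImage_spanImage_of_comp_eq_id {S S' : Type*} [CommRing S] [CommRing S']
    {R : Subring S} {R' : Subring S'} {φ : S →+* S'} (hφ : R ≤ R'.comap φ) {ψ : S' →+* S}
    (hψ : R' ≤ R.comap ψ) (h : ∀ x, ψ (φ x) = x) (J : Submodule R S) :
    spanImage ψ hψ (spanImage φ hφ J) = J := by
  refine le_antisymm (span_le.mpr ?_) fun x hx =>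
    subset_span ⟨φ x, subset_span ⟨x, hx, rfl⟩, h x⟩
  rintro _ ⟨x, hx, rfl⟩
  rw [spanImage_apply] at hx
  induction hx using span_induction with
  | mem x hx =>
    obtain ⟨y, hy, rfl⟩ := hx
    rwa [h]
  | zero => rw [map_zero]; exact zero_mem _
  | add x y _ _ hx hy => rw [map_add]; exact add_mem hx hy
  | smul r x _ hx =>
    rw [Subring.smul_def, smul_eq_mul, map_mul]
    exact J.smul_mem ⟨ψ r, hψ r.2⟩ hx

/-- An element of a product of submodules is a finite sum of products. -/
theorem exists_sum_mul_of_mem_mul {R S : Type*} [CommRing R] [CommRing S] [Algebra R S]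
    {J K : Submodule R S} {x : S} (hx : x ∈ J * K) :
    ∃ (n : ℕ) (f g : Fin n → S), (∀ i, f i ∈ J) ∧ (∀ i, g i ∈ K) ∧ ∑ i, f i * g i = x := by
  refine Submodule.mul_induction_on hx (fun a ha b hb => ?_) fun a b ha hb => ?_
  · exact ⟨1, fun _ => a, fun _ => b, fun _ => ha, fun _ => hb, by simp⟩
  · obtain ⟨n, f, g, hf, hg, rfl⟩ := ha
    obtain ⟨n', f', g', hf', hg', rfl⟩ := hb
    refine ⟨n + n', Fin.append f f', Fin.append g g', ?_, ?_, ?_⟩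
    · exact Fin.addCases (by simpa using hf) (by simpa using hf')
    · exact Fin.addCases (by simpa using hg) (by simpa using hg')
    · simp [Fin.sum_univ_add]

end Submodule

section PolynomialSubringX

variable {B : Type*} [CommRing B] {A : Subring B} {m n : ℕ}

theorem mem_polynomialSubringX {p : MvPolynomial (Fin m ⊕ Fin n) B} :
    p ∈ polynomialSubringX A m n ↔ ∃ q : MvPolynomial (Fin m) A,
      MvPolynomial.rename Sum.inl (MvPolynomial.map A.subtype q) = p :=
  Iff.rfl

theorem coeff_mem_of_mem_polynomialSubringX {p : MvPolynomial (Fin m ⊕ Fin n) B}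
    (hp : p ∈ polynomialSubringX A m n) (d : Fin m ⊕ Fin n →₀ ℕ) : p.coeff d ∈ A := by
  obtain ⟨q, rfl⟩ := mem_polynomialSubringX.mp hp
  rw [← MvPolynomial.map_rename, MvPolynomial.coeff_map]
  exact Subtype.property _

theorem constantCoeff_mem_of_mem_polynomialSubringX {p : MvPolynomial (Fin m ⊕ Fin n) B}
    (hp : p ∈ polynomialSubringX A m n) : MvPolynomial.constantCoeff p ∈ A :=
  coeff_mem_of_mem_polynomialSubringX hp 0

theorem C_mem_polynomialSubringX {a : B} (ha : a ∈ A) :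
    MvPolynomial.C a ∈ polynomialSubringX A m n :=
  mem_polynomialSubringX.mpr ⟨MvPolynomial.C ⟨a, ha⟩, by simp⟩

theorem X_inl_mem_polynomialSubringX (i : Fin m) :
    MvPolynomial.X (Sum.inl i) ∈ polynomialSubringX A m n :=
  mem_polynomialSubringX.mpr ⟨MvPolynomial.X i, by simp⟩

/-- The endomorphism of `B[X,Y]` setting all the variables `Y` to zero. -/
def killY (B : Type*) [CommRing B] (m n : ℕ) :
    MvPolynomial (Fin m ⊕ Fin n) B →+* MvPolynomial (Fin m ⊕ Fin n) B :=
  MvPolynomial.eval₂Hom MvPolynomial.C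
    (Sum.elim (fun i => MvPolynomial.X (Sum.inl i)) fun _ => 0)

theorem killY_mem_polynomialSubringX {p : MvPolynomial (Fin m ⊕ Fin n) B}
    (hp : ∀ d, p.coeff d ∈ A) : killY B m n p ∈ polynomialSubringX A m n := by
  rw [killY, MvPolynomial.coe_eval₂Hom, MvPolynomial.eval₂_eq]
  refine Subring.sum_mem _ fun d _ => Subring.mul_mem _ (C_mem_polynomialSubringX (hp d))
    (Subring.prod_mem _ fun i _ => Subring.pow_mem _ ?_ _)
  rcases i with i | i
  · exact X_inl_mem_polynomialSubringX i
  · exact Subring.zero_mem _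

theorem killY_eq_self_of_mem_polynomialSubringX {p : MvPolynomial (Fin m ⊕ Fin n) B}
    (hp : p ∈ polynomialSubringX A m n) : killY B m n p = p := by
  obtain ⟨q, rfl⟩ := mem_polynomialSubringX.mp hp
  have : (killY B m n).comp (MvPolynomial.rename (R := B) Sum.inl).toRingHom =
      (MvPolynomial.rename (R := B) (Sum.inl : Fin m → Fin m ⊕ Fin n)).toRingHom := by
    refine MvPolynomial.ringHom_ext (fun b => ?_) fun i => ?_ <;> simp [killY]
  exact congrArg (fun h => h (MvPolynomial.map A.subtype q)) this

/-- If `J K = A[X]` and the constant coefficients of `J` and `K` lie in `A`, then `1 ∈ J`. -/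
theorem one_mem_of_mul_eq_one_of_constantCoeff_mem [IsReduced B] (hA : A.IsSubintegrallyClosedIn)
    {J K : Submodule (polynomialSubringX A m n) (MvPolynomial (Fin m ⊕ Fin n) B)} (hJK : J * K = 1)
    (hJ : ∀ p ∈ J, MvPolynomial.constantCoeff p ∈ A)
    (hK : ∀ p ∈ K, MvPolynomial.constantCoeff p ∈ A) : 1 ∈ J := by
  have hmem {p q} (hp : p ∈ J) (hq : q ∈ K) : p * q ∈ polynomialSubringX A m n := by
    have : p * q ∈ J * K := Submodule.mul_mem_mul hp hq
    rw [hJK] at this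
    obtain ⟨r, hr⟩ := Submodule.mem_one.mp this
    exact hr ▸ r.2
  obtain ⟨N, f, g, hf, hg, hsum⟩ := Submodule.exists_sum_mul_of_mem_mul
    (hJK ▸ Submodule.one_le.mp le_rfl : (1 : MvPolynomial (Fin m ⊕ Fin n) B) ∈ J * K)
  have hfA (i : Fin N) (d) : (f i).coeff d ∈ A :=
    MvPolynomial.coeff_mem_of_factorization hA
      (fun i j => coeff_mem_of_mem_polynomialSubringX (hmem (hf i) (hg j))) hsum
      (fun i => hJ _ (hf i)) (fun i => hK _ (hg i)) i d
  have hgA (i : Fin N) (d) : (g i).coeff d ∈ A :=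
    MvPolynomial.coeff_mem_of_factorization hA
      (fun i j => coeff_mem_of_mem_polynomialSubringX (mul_comm (f j) (g i) ▸ hmem (hf j) (hg i)))
      (by simpa only [mul_comm] using hsum) (fun i => hK _ (hg i)) (fun i => hJ _ (hf i)) i d
  have hidem (p : MvPolynomial (Fin m ⊕ Fin n) B) (hp : ∀ d, p.coeff d ∈ A) :
      killY B m n (killY B m n p) = killY B m n p :=
    killY_eq_self_of_mem_polynomialSubringX (killY_mem_polynomialSubringX hp)
  set F := ∑ i, killY B m n (g i) * f i with hF
  set G := ∑ i, killY B m n (f i) * g i with hG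
  have hFJ : F ∈ J := J.sum_mem fun i _ =>
    J.smul_mem (⟨_, killY_mem_polynomialSubringX (hgA i)⟩ : polynomialSubringX A m n) (hf i)
  have hGK : G ∈ K := K.sum_mem fun i _ =>
    K.smul_mem (⟨_, killY_mem_polynomialSubringX (hfA i)⟩ : polynomialSubringX A m n) (hg i)
  have hsumY : ∑ i, killY B m n (f i) * killY B m n (g i) = 1 := by
    simpa using congrArg (killY B m n) hsum
  have hF1 : killY B m n F = 1 := by
    simp only [hF, map_sum, map_mul, hidem _ (hgA _)]
    simpa only [mul_comm] using hsumY
  have hG1 : killY B m n G = 1 := by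
    simp only [hG, map_sum, map_mul, hidem _ (hfA _)]
    exact hsumY
  have hFG : F * G = 1 := by
    rw [← killY_eq_self_of_mem_polynomialSubringX (hmem hFJ hGK), map_mul, hF1, hG1, mul_one]
  obtain ⟨b, -, hb⟩ := MvPolynomial.isUnit_iff_eq_C_of_isReduced.mp (IsUnit.of_mul_eq_one G hFG)
  have : F = 1 := by
    rw [← hF1, hb]
    simp [killY]
  exact this ▸ hFJ

theorem eq_one_of_mul_eq_one_of_constantCoeff_mem [IsReduced B] (hA : A.IsSubintegrallyClosedIn)
    {J K : Submodule (polynomialSubringX A m n) (MvPolynomial (Fin m ⊕ Fin n) B)} (hJK : J * K = 1)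
    (hJ : ∀ p ∈ J, MvPolynomial.constantCoeff p ∈ A)
    (hK : ∀ p ∈ K, MvPolynomial.constantCoeff p ∈ A) : J = 1 := by
  have h1J := Submodule.one_le.mpr (one_mem_of_mul_eq_one_of_constantCoeff_mem hA hJK hJ hK)
  have h1K := Submodule.one_le.mpr
    (one_mem_of_mul_eq_one_of_constantCoeff_mem hA ((mul_comm K J).trans hJK) hK hJ)
  refine le_antisymm ?_ h1J
  calc J = J * 1 := (mul_one J).symm
    _ ≤ J * K := mul_le_mul_right h1K J
    _ = 1 := hJK

end PolynomialSubringX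

/-- **Sarwar, Corollary 3.5.**  Let `A ⊆ B` be an extension of reduced commutative rings with
`A` subintegrally closed in `B`, and `m n : ℕ`.  Then the canonical map
`𝓘(A,B) → 𝓘(A[X₁,…,X_m], B[X₁,…,X_m,Y₁,…,Y_n])`, sending an invertible `A`-submodule `I` of
`B` to the `A[X₁,…,X_m]`-submodule generated by (the image of) `I`, is an isomorphism. -/
theorem theta_isIso_polynomial
    {B : Type*} [CommRing B] [IsReduced B] (A : Subring B)
    (hA : A.IsSubintegrallyClosedIn) (m n : ℕ) :
    ∃ e : (Submodule A B)ˣ ≃*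
        (Submodule (polynomialSubringX A m n) (MvPolynomial (Fin m ⊕ Fin n) B))ˣ,
      ∀ I : (Submodule A B)ˣ,
        (e I : Submodule (polynomialSubringX A m n) (MvPolynomial (Fin m ⊕ Fin n) B)) =
          Submodule.span (polynomialSubringX A m n)
            (⇑(MvPolynomial.C : B →+* MvPolynomial (Fin m ⊕ Fin n) B) ''
              ((I : Submodule A B) : Set B)) := by
  have hC : A ≤ (polynomialSubringX A m n).comap MvPolynomial.C :=
    fun a ha => C_mem_polynomialSubringX ha
  have hc : polynomialSubringX A m n ≤ A.comap MvPolynomial.constantCoeff :=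
    fun p hp => constantCoeff_mem_of_mem_polynomialSubringX hp
  set extend := Units.map (Submodule.spanImage _ hC)
  set restrict := Units.map (Submodule.spanImage _ hc)
  have hleft (I : (Submodule A B)ˣ) : restrict (extend I) = I :=
    Units.ext (Submodule.spanImage_spanImage_of_comp_eq_id hC hc
      (fun x => MvPolynomial.constantCoeff_C _ x) _)
  have hmem (J) (hJ : restrict J = 1) (p : MvPolynomial (Fin m ⊕ Fin n) B) (hp : p ∈ J.val) :
      MvPolynomial.constantCoeff p ∈ A := by
    have h : MvPolynomial.constantCoeff p ∈ (restrict J).val := Submodule.subset_span ⟨p, hp, rfl⟩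
    rw [hJ, Units.val_one] at h
    obtain ⟨a, ha⟩ := Submodule.mem_one.mp h
    exact ha ▸ a.2
  have hker (J) (hJ : restrict J = 1) : J = 1 :=
    Units.ext (eq_one_of_mul_eq_one_of_constantCoeff_mem hA J.mul_inv (hmem J hJ)
      (hmem J⁻¹ (by rw [map_inv, hJ, inv_one])))
  have hbij : Function.Bijective extend := by
    refine ⟨Function.LeftInverse.injective hleft, fun J => ⟨restrict J, ?_⟩⟩
    refine mul_inv_eq_one.mp (hker _ ?_)
    rw [map_mul, map_inv, hleft, mul_inv_cancel]
  exact ⟨MulEquiv.ofBijective extend hbij, fun I => rfl⟩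
end
end

section
/- Let A ⊆ B be an extension of commutative rings, let ⁺A denote the subintegral closure of A in B, and let M be a positive commutative cancellative torsion-free monoid. Then both sequences of abelian groups 1 → 𝓘(A,⁺A) → 𝓘(A,B) → 𝓘(⁺A,B) → 1 and 1 → 𝓘(A[M],(⁺A)[M]) → 𝓘(A[M],B[M]) → 𝓘((⁺A)[M],B[M]) → 1 are exact, where in each sequence the first map is induced by the inclusion of rings (an invertible A-submodule of ⁺A is viewed as an A-submodule of B, and similarly with [M]), and the second map sends an invertible A-submodule I to the ⁺A-submodule ⁺A·I generated by I (respectively I ↦ (⁺A)[M]·I). -/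
open scoped Classical

noncomputable section

set_option maxHeartbeats 1000000

/-- The subintegral closure of `A` in an intermediate ring `C` (for `A ⊆ C ⊆ B`): the smallest
subring `T` of `B` containing `A` such that every `b ∈ C` with `b² ∈ T` and `b³ ∈ T` lies in
`T`. -/
def Subring.subintegralClosureIn {B : Type*} [CommRing B] (A C : Subring B) : Subring B :=
  sInf {T : Subring B | A ≤ T ∧ ∀ b ∈ C, b ^ 2 ∈ T → b ^ 3 ∈ T → b ∈ T}

/-- The subintegral closure `⁺A` of `A` in `B`: the smallest subring `T` of `B` containing `A`
such that every `b : B` with `b² ∈ T` and `b³ ∈ T` lies in `T`. -/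
def Subring.subintegralClosure {B : Type*} [CommRing B] (A : Subring B) : Subring B :=
  A.subintegralClosureIn ⊤

/-- The subintegral closure of `M` in an intermediate monoid `C` (for `M ⊆ C ⊆ G`): the
smallest submonoid `T` of `G` containing `M` such that every `x ∈ C` with `x² ∈ T` and
`x³ ∈ T` lies in `T`. -/
def Submonoid.subintegralClosureIn {G : Type*} [CommMonoid G] (M C : Submonoid G) : Submonoid G :=
  sInf {T : Submonoid G | M ≤ T ∧ ∀ x ∈ C, x ^ 2 ∈ T → x ^ 3 ∈ T → x ∈ T}

theorem sub_mul_mul_eq_of_idempotent {R : Type*} [Ring R] {a δ : R}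
    (h : (a + δ) * (a + δ) = a + δ) :
    (a + δ) - a * (a + δ) * a = δ * (a + δ) + (a + δ) * δ - δ * (a + δ) * δ := by
  have h3 : (a + δ) * (a + δ) * (a + δ) = a + δ := by rw [h, h]
  calc (a + δ) - a * (a + δ) * a
      = (a + δ) - (a + δ) * (a + δ) * (a + δ) + δ * ((a + δ) * (a + δ))
        + (a + δ) * (a + δ) * δ - δ * (a + δ) * δ := by noncomm_ring
    _ = _ := by rw [h3, h, sub_self, zero_add]

section MatrixEntries

variable {B ι : Type*} [CommRing B] [Fintype ι]

theorem Matrix.mul_apply_mem_of_forall_mem {S T U : AddSubgroup B}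
    (h : ∀ s ∈ S, ∀ t ∈ T, s * t ∈ U) {X Y : Matrix ι ι B}
    (hX : ∀ i j, X i j ∈ S) (hY : ∀ i j, Y i j ∈ T) (i j : ι) : (X * Y) i j ∈ U := by
  rw [Matrix.mul_apply]
  exact sum_mem fun k _ => h _ (hX i k) _ (hY k j)

/-- If an idempotent matrix `a + δ` differs from a matrix `a` over `A` by a matrix `δ` over an
ideal `𝔟` of `C` with `𝔟 * 𝔟 ⊆ 𝔠 ⊆ A`, then `a * (a + δ) * a` has entries in `A`. -/
theorem Matrix.mul_idempotent_mul_apply_mem {A C : Subring B} (hAC : A ≤ C)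
    {𝔟 𝔠 : AddSubgroup B} (hCb : ∀ s ∈ C, ∀ t ∈ 𝔟, s * t ∈ 𝔟) (hbb : ∀ s ∈ 𝔟, ∀ t ∈ 𝔟, s * t ∈ 𝔠)
    (hCc : ∀ s ∈ C, ∀ t ∈ 𝔠, s * t ∈ 𝔠) (hbC : 𝔟 ≤ C.toAddSubgroup) (hcA : 𝔠 ≤ A.toAddSubgroup)
    {a δ : Matrix ι ι B} (ha : ∀ i j, a i j ∈ A) (hδ : ∀ i j, δ i j ∈ 𝔟)
    (he : (a + δ) * (a + δ) = a + δ) (i j : ι) : (a * (a + δ) * a) i j ∈ A := by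
  have key : a * (a + δ) * a = a * a + (a * δ + δ * a + δ * δ - δ) * δ - a * (δ * δ) := by
    have h1 : a * δ + δ * a + δ * δ - δ = a - a * a := by
      have : (a + δ) * (a + δ) - (a + δ) = 0 := sub_eq_zero.mpr he
      rw [← sub_eq_zero, ← this]
      noncomm_ring
    have h2 : δ * a = a - a * a + δ - a * δ - δ * δ := by
      rw [← h1]
      abel
    rw [h1, mul_assoc, add_mul, h2]
    noncomm_ring
  have haC : ∀ i j, a i j ∈ C.toAddSubgroup := fun i j => hAC (ha i j)
  have hδC : ∀ i j, δ i j ∈ C.toAddSubgroup := fun i j => hbC (hδ i j)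
  have hbC' : ∀ s ∈ 𝔟, ∀ t ∈ C.toAddSubgroup, s * t ∈ 𝔟 := fun s hs t ht => by
    rw [mul_comm]
    exact hCb t ht s hs
  have haa := Matrix.mul_apply_mem_of_forall_mem (S := A.toAddSubgroup) (T := A.toAddSubgroup)
    (U := A.toAddSubgroup) (fun s hs t ht => A.mul_mem hs ht) ha ha
  have haδ := Matrix.mul_apply_mem_of_forall_mem (S := C.toAddSubgroup) hCb haC hδ
  have hδa := Matrix.mul_apply_mem_of_forall_mem hbC' hδ haC
  have hδδ := Matrix.mul_apply_mem_of_forall_mem hbC' hδ hδC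
  have hδδc := Matrix.mul_apply_mem_of_forall_mem hbb hδ hδ
  have hrδ := Matrix.mul_apply_mem_of_forall_mem hbb (X := a * δ + δ * a + δ * δ - δ)
    (fun i j => sub_mem (add_mem (add_mem (haδ i j) (hδa i j)) (hδδ i j)) (hδ i j)) hδ
  have haδδ := Matrix.mul_apply_mem_of_forall_mem (S := C.toAddSubgroup) hCc haC hδδc
  rw [key]
  exact sub_mem (add_mem (haa i j) (hcA (hrδ i j))) (hcA (haδδ i j))

end MatrixEntries

section InvertiblePairs

variable {B : Type*} [CommRing B]

/-- Finite families `x`, `y` in `B` that generate mutually inverse `A`-submodules of `B`. -/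
structure IsInvertiblePair (A : Subring B) {ι : Type} [Fintype ι] (x y : ι → B) : Prop where
  sum_mul_eq_one : ∑ i, x i * y i = 1
  mul_mem : ∀ i j, x i * y j ∈ A

/-- The subring `A + A b` of `B`, where `b ^ 2` and `b ^ 3` lie in `A`. -/
def Subring.adjoinElementary (A : Subring B) (b : B) (h2 : b ^ 2 ∈ A) : Subring B where
  carrier := {x | ∃ p ∈ A, ∃ q ∈ A, x = p + q * b}
  zero_mem' := ⟨0, A.zero_mem, 0, A.zero_mem, by ring⟩
  one_mem' := ⟨1, A.one_mem, 0, A.zero_mem, by ring⟩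
  add_mem' := by
    rintro _ _ ⟨p, hp, q, hq, rfl⟩ ⟨p', hp', q', hq', rfl⟩
    exact ⟨p + p', A.add_mem hp hp', q + q', A.add_mem hq hq', by ring⟩
  neg_mem' := by
    rintro _ ⟨p, hp, q, hq, rfl⟩
    exact ⟨-p, A.neg_mem hp, -q, A.neg_mem hq, by ring⟩
  mul_mem' := by
    rintro _ _ ⟨p, hp, q, hq, rfl⟩ ⟨p', hp', q', hq', rfl⟩
    exact ⟨p * p' + q * q' * b ^ 2,
      A.add_mem (A.mul_mem hp hp') (A.mul_mem (A.mul_mem hq hq') h2),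
      p * q' + q * p', A.add_mem (A.mul_mem hp hq') (A.mul_mem hq hp'), by ring⟩

theorem Subring.mem_adjoinElementary {A : Subring B} {b : B} {h2 : b ^ 2 ∈ A} {x : B} :
    x ∈ A.adjoinElementary b h2 ↔ ∃ p ∈ A, ∃ q ∈ A, x = p + q * b :=
  Iff.rfl

theorem Subring.le_adjoinElementary (A : Subring B) (b : B) (h2 : b ^ 2 ∈ A) :
    A ≤ A.adjoinElementary b h2 :=
  fun a ha => ⟨a, ha, 0, A.zero_mem, by ring⟩

theorem Subring.self_mem_adjoinElementary (A : Subring B) (b : B) (h2 : b ^ 2 ∈ A) :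
    b ∈ A.adjoinElementary b h2 :=
  ⟨0, A.zero_mem, 1, A.one_mem, by ring⟩

theorem Subring.adjoinElementary_le {A D : Subring B} {b : B} (h2 : b ^ 2 ∈ A) (hA : A ≤ D)
    (hb : b ∈ D) : A.adjoinElementary b h2 ≤ D := by
  rintro _ ⟨p, hp, q, hq, rfl⟩
  exact D.add_mem (hA hp) (D.mul_mem (hA hq) hb)

/-- Invertible pairs descend along an elementary subintegral extension. -/
theorem IsInvertiblePair.exists_descent_adjoinElementary {A D : Subring B} {b : B}
    (h2 : b ^ 2 ∈ A) (h3 : b ^ 3 ∈ A) (hD : A.adjoinElementary b h2 ≤ D)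
    {ι : Type} [Fintype ι] {x y : ι → B} (h : IsInvertiblePair (A.adjoinElementary b h2) x y) :
    ∃ (κ : Type) (_ : Fintype κ) (x' y' : κ → B), IsInvertiblePair A x' y' ∧
      (∀ k, x' k ∈ Submodule.span D (Set.range x)) ∧
      (∀ k, y' k ∈ Submodule.span D (Set.range y)) := by
  set C := A.adjoinElementary b h2
  have hAC : A ≤ C := A.le_adjoinElementary b h2
  have hbC : b ∈ C := A.self_mem_adjoinElementary b h2
  let 𝔟 : AddSubgroup B := C.toAddSubgroup.map (AddMonoidHom.mulLeft b)
  let 𝔠 : AddSubgroup B := C.toAddSubgroup.map (AddMonoidHom.mulLeft (b ^ 2))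
  have mem_b : ∀ {s}, s ∈ 𝔟 ↔ ∃ c ∈ C, b * c = s := Iff.rfl
  have mem_c : ∀ {s}, s ∈ 𝔠 ↔ ∃ c ∈ C, b ^ 2 * c = s := Iff.rfl
  have hCb : ∀ s ∈ C, ∀ t ∈ 𝔟, s * t ∈ 𝔟 := by
    rintro s hs _ ⟨t, ht, rfl⟩
    exact ⟨s * t, C.mul_mem hs ht, mul_left_comm b s t⟩
  have hCc : ∀ s ∈ C, ∀ t ∈ 𝔠, s * t ∈ 𝔠 := by
    rintro s hs _ ⟨t, ht, rfl⟩
    exact ⟨s * t, C.mul_mem hs ht, mul_left_comm (b ^ 2) s t⟩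
  have hbb : ∀ s ∈ 𝔟, ∀ t ∈ 𝔟, s * t ∈ 𝔠 := by
    intro s hs t ht
    obtain ⟨s', hs', rfl⟩ := mem_b.1 hs
    obtain ⟨t', ht', rfl⟩ := mem_b.1 ht
    exact mem_c.2 ⟨s' * t', C.mul_mem hs' ht', by ring⟩
  have hb_le : 𝔟 ≤ C.toAddSubgroup := by
    rintro _ ⟨t, ht, rfl⟩
    exact C.mul_mem hbC ht
  have hc_le : 𝔠 ≤ A.toAddSubgroup := by
    rintro _ ⟨_, ⟨p, hp, q, hq, rfl⟩, rfl⟩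
    change b ^ 2 * (p + q * b) ∈ A
    rw [show b ^ 2 * (p + q * b) = b ^ 2 * p + q * b ^ 3 by ring]
    exact A.add_mem (A.mul_mem h2 hp) (A.mul_mem hq h3)
  choose a ha q hq he using fun i j => Subring.mem_adjoinElementary.1 (h.mul_mem i j)
  let α : Matrix ι ι B := Matrix.of a
  let δ : Matrix ι ι B := Matrix.of fun i j => q i j * b
  have heq : ∀ i j, (α + δ) i j = x i * y j := fun i j => (he i j).symm
  have hα : ∀ i j, α i j ∈ A := ha
  have hδ : ∀ i j, δ i j ∈ 𝔟 := fun i j => mem_b.2 ⟨q i j, hAC (hq i j), mul_comm _ _⟩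
  have hidem : (α + δ) * (α + δ) = α + δ := by
    ext i j
    rw [Matrix.mul_apply]
    simp only [heq]
    calc ∑ k, x i * y k * (x k * y j) = x i * y j * ∑ k, x k * y k := by
          rw [Finset.mul_sum]
          exact Finset.sum_congr rfl fun k _ => by ring
      _ = _ := by rw [h.sum_mul_eq_one, mul_one]
  have hmem := Matrix.mul_idempotent_mul_apply_mem hAC hCb hbb hCc hb_le hc_le hα hδ hidem
  let z : ι → B := fun i => ∑ k, α i k * x k
  let w : ι → B := fun j => ∑ l, y l * α l j
  have hzw : ∀ i j, z i * w j = (α * (α + δ) * α) i j := by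
    intro i j
    rw [Matrix.mul_assoc, Matrix.mul_apply]
    simp only [Matrix.mul_apply, heq, z, w, Finset.sum_mul]
    refine Finset.sum_congr rfl fun k _ => ?_
    simp only [Finset.mul_sum]
    exact Finset.sum_congr rfl fun l _ => by ring
  let β : B := 1 - ∑ i, z i * w i
  have hβA : β ∈ A := A.sub_mem A.one_mem (A.sum_mem fun i _ => by rw [hzw]; exact hmem i i)
  have hβb : β ∈ 𝔟 := by
    have hbC' : ∀ s ∈ 𝔟, ∀ t ∈ C.toAddSubgroup, s * t ∈ 𝔟 := fun s hs t ht => by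
      rw [mul_comm]
      exact hCb t ht s hs
    have heC : ∀ i j, (α + δ) i j ∈ C.toAddSubgroup := fun i j => by
      rw [heq]
      exact h.mul_mem i j
    have h1 := Matrix.mul_apply_mem_of_forall_mem hbC' hδ heC
    have h2 := Matrix.mul_apply_mem_of_forall_mem (S := C.toAddSubgroup) hCb heC hδ
    have h3 := Matrix.mul_apply_mem_of_forall_mem hbC' h1 (fun i j => hb_le (hδ i j))
    have hdiff := sub_mul_mul_eq_of_idempotent hidem
    have hβ : β = ∑ i, ((α + δ) - α * (α + δ) * α) i i := by
      simp only [Matrix.sub_apply, Finset.sum_sub_distrib, heq, h.sum_mul_eq_one, ← hzw, β]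
    rw [hβ]
    refine sum_mem fun i _ => ?_
    rw [hdiff]
    exact sub_mem (add_mem (h1 i i) (h2 i i)) (h3 i i)
  have hβC : ∀ c ∈ C, β ^ 2 * c ∈ A := fun c hc => by
    refine hc_le ?_
    rw [mul_comm, pow_two]
    exact hCc c hc _ (hbb _ hβb _ hβb)
  have hx : ∀ i, x i ∈ Submodule.span D (Set.range x) := fun i =>
    Submodule.subset_span ⟨i, rfl⟩
  have hy : ∀ i, y i ∈ Submodule.span D (Set.range y) := fun i =>
    Submodule.subset_span ⟨i, rfl⟩
  have smul_span : ∀ (N : Submodule D B), ∀ c ∈ A, ∀ v ∈ N, c * v ∈ N := fun N c hc v hv =>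
    N.smul_mem (⟨c, hD (hAC hc)⟩ : D) hv
  have hz : ∀ i, z i ∈ Submodule.span D (Set.range x) := fun i =>
    sum_mem fun k _ => smul_span _ _ (hα i k) _ (hx k)
  have hw : ∀ i, w i ∈ Submodule.span D (Set.range y) := fun i =>
    sum_mem fun k _ => by
      rw [mul_comm]
      exact smul_span _ _ (hα k i) _ (hy k)
  have hzy : ∀ i j, z i * y j ∈ C := fun i j => by
    simp only [z, Finset.sum_mul]
    exact C.sum_mem fun k _ => by
      rw [mul_assoc]
      exact C.mul_mem (hAC (hα i k)) (h.mul_mem k j)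
  have hxw : ∀ i j, x i * w j ∈ C := fun i j => by
    simp only [w, Finset.mul_sum]
    exact C.sum_mem fun k _ => by
      rw [← mul_assoc]
      exact C.mul_mem (h.mul_mem i k) (hAC (hα k j))
  have hγ : (1 + β) * (1 + β ^ 2) ∈ A :=
    A.mul_mem (A.add_mem A.one_mem hβA) (A.add_mem A.one_mem (A.pow_mem hβA 2))
  refine ⟨ι ⊕ ι, inferInstance,
    Sum.elim (fun i => (1 + β) * (1 + β ^ 2) * z i) (fun i => β ^ 2 * x i),
    Sum.elim w (fun i => β ^ 2 * y i), ⟨?_, ?_⟩, ?_, ?_⟩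
  · simp only [Fintype.sum_sum_type, Sum.elim_inl, Sum.elim_inr]
    have e1 : ∑ i, (1 + β) * (1 + β ^ 2) * z i * w i = (1 + β) * (1 + β ^ 2) * (1 - β) := by
      simp only [mul_assoc, ← Finset.mul_sum]
      simp only [β, sub_sub_cancel]
    have e2 : ∑ i, β ^ 2 * x i * (β ^ 2 * y i) = β ^ 4 := by
      calc ∑ i, β ^ 2 * x i * (β ^ 2 * y i) = β ^ 4 * ∑ i, x i * y i := by
            rw [Finset.mul_sum]
            exact Finset.sum_congr rfl fun k _ => by ring
        _ = _ := by rw [h.sum_mul_eq_one, mul_one]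
    rw [e1, e2]
    ring
  · rintro (i | i) (j | j) <;> simp only [Sum.elim_inl, Sum.elim_inr]
    · rw [mul_assoc, hzw]
      exact A.mul_mem hγ (hmem i j)
    · rw [show (1 + β) * (1 + β ^ 2) * z i * (β ^ 2 * y j)
        = (1 + β) * (1 + β ^ 2) * (β ^ 2 * (z i * y j)) by ring]
      exact A.mul_mem hγ (hβC _ (hzy i j))
    · rw [mul_assoc]
      exact hβC _ (hxw i j)
    · rw [show β ^ 2 * x i * (β ^ 2 * y j) = β ^ 2 * (β ^ 2 * (x i * y j)) by ring]
      exact A.mul_mem (A.pow_mem hβA 2) (hβC _ (h.mul_mem i j))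
  · rintro (i | i)
    · exact smul_span _ _ hγ _ (hz i)
    · exact smul_span _ _ (A.pow_mem hβA 2) _ (hx i)
  · rintro (i | i)
    · exact hw i
    · exact smul_span _ _ (A.pow_mem hβA 2) _ (hy i)

/-- Subrings obtained from `A` by finitely many elementary subintegral extensions inside `D`. -/
inductive Subring.IsElementaryTower (A D : Subring B) : Subring B → Prop
  | base : IsElementaryTower A D A
  | step {T : Subring B} {b : B} (hT : IsElementaryTower A D T) (hb : b ∈ D) (h2 : b ^ 2 ∈ T)
      (h3 : b ^ 3 ∈ T) : IsElementaryTower A D (T.adjoinElementary b h2)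

namespace Subring.IsElementaryTower

variable {A D : Subring B}

theorem le (hAD : A ≤ D) {T : Subring B} (hT : A.IsElementaryTower D T) : T ≤ D := by
  induction hT with
  | base => exact hAD
  | step _ hb h2 _ ih => exact Subring.adjoinElementary_le h2 ih hb

theorem exists_ge_ge {T₁ T₂ : Subring B} (h₁ : A.IsElementaryTower D T₁)
    (h₂ : A.IsElementaryTower D T₂) : ∃ T, A.IsElementaryTower D T ∧ T₁ ≤ T ∧ T₂ ≤ T := by
  have hA : ∀ {T : Subring B}, A.IsElementaryTower D T → A ≤ T := fun hT => by
    induction hT with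
    | base => exact le_rfl
    | step _ _ h2 _ ih => exact ih.trans (Subring.le_adjoinElementary _ _ h2)
  induction h₂ with
  | base => exact ⟨T₁, h₁, le_rfl, hA h₁⟩
  | step _ hb h2 h3 ih =>
    obtain ⟨T, hT, h1T, h2T⟩ := ih
    exact ⟨_, hT.step hb (h2T h2) (h2T h3), h1T.trans (Subring.le_adjoinElementary _ _ _),
      Subring.adjoinElementary_le h2 (h2T.trans (Subring.le_adjoinElementary _ _ _))
        (Subring.self_mem_adjoinElementary _ _ _)⟩

instance : IsDirectedOrder {T : Subring B // A.IsElementaryTower D T} where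
  directed T₁ T₂ :=
    let ⟨T, hT, h1, h2⟩ := T₁.2.exists_ge_ge T₂.2
    ⟨⟨T, hT⟩, h1, h2⟩

instance : Nonempty {T : Subring B // A.IsElementaryTower D T} :=
  ⟨⟨A, .base⟩⟩

theorem exists_mem {x : B} (hx : x ∈ A.subintegralClosureIn D) :
    ∃ T, A.IsElementaryTower D T ∧ x ∈ T := by
  let U : Subring B := ⨆ T : {T : Subring B // A.IsElementaryTower D T}, T.1
  have mem_U : ∀ {z}, z ∈ U ↔ ∃ T, A.IsElementaryTower D T ∧ z ∈ T := by
    intro z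
    refine (Subring.mem_iSup_of_directed ?_).trans (by simp)
    exact fun T₁ T₂ => directed_of (· ≤ ·) T₁ T₂
  refine mem_U.1 (Subring.mem_sInf.1 hx U ⟨fun a ha => mem_U.2 ⟨A, .base, ha⟩, ?_⟩)
  intro b hb h2 h3
  obtain ⟨T₁, h₁, hb2⟩ := mem_U.1 h2
  obtain ⟨T₂, h₂, hb3⟩ := mem_U.1 h3
  obtain ⟨T, hT, h1T, h2T⟩ := h₁.exists_ge_ge h₂
  exact mem_U.2 ⟨_, hT.step hb (h1T hb2) (h2T hb3), Subring.self_mem_adjoinElementary _ _ _⟩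

theorem exists_forall_mem {κ : Type*} [Finite κ] {f : κ → B}
    (hf : ∀ k, f k ∈ A.subintegralClosureIn D) : ∃ T, A.IsElementaryTower D T ∧ ∀ k, f k ∈ T := by
  choose T hT hfT using fun k => exists_mem (hf k)
  obtain ⟨S, hS⟩ := Finite.exists_le fun k =>
    (⟨T k, hT k⟩ : {T : Subring B // A.IsElementaryTower D T})
  exact ⟨S.1, S.2, fun k => hS k (hfT k)⟩

/-- Invertible pairs descend along finite towers of elementary subintegral extensions. -/
theorem exists_descent (hAD : A ≤ D) {T : Subring B} (hT : A.IsElementaryTower D T)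
    {ι : Type} [Fintype ι] {x y : ι → B} (h : IsInvertiblePair T x y) :
    ∃ (κ : Type) (_ : Fintype κ) (x' y' : κ → B), IsInvertiblePair A x' y' ∧
      (∀ k, x' k ∈ Submodule.span D (Set.range x)) ∧
      (∀ k, y' k ∈ Submodule.span D (Set.range y)) := by
  induction hT generalizing ι with
  | base =>
    exact ⟨ι, inferInstance, x, y, h, fun k => Submodule.subset_span ⟨k, rfl⟩,
      fun k => Submodule.subset_span ⟨k, rfl⟩⟩
  | step hT hb h2 h3 ih =>
    obtain ⟨κ, _, x', y', h', hx', hy'⟩ :=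
      h.exists_descent_adjoinElementary h2 h3 ((hT.step hb h2 h3).le hAD)
    obtain ⟨l, hl, x'', y'', h'', hx'', hy''⟩ := ih h'
    exact ⟨l, hl, x'', y'', h'',
      fun k => Submodule.span_le.2 (Set.range_subset_iff.2 hx') (hx'' k),
      fun k => Submodule.span_le.2 (Set.range_subset_iff.2 hy') (hy'' k)⟩

end Subring.IsElementaryTower

end InvertiblePairs

section InvertibleSubmodules

variable {B : Type*} [CommRing B]

theorem Submodule.exists_fintype_sum_of_mem_mul {A : Subring B} {I J : Submodule A B} {z : B}
    (hz : z ∈ I * J) : ∃ (ι : Type) (_ : Fintype ι) (x y : ι → B),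
      (∀ i, x i ∈ I) ∧ (∀ i, y i ∈ J) ∧ ∑ i, x i * y i = z := by
  induction hz using Submodule.mul_induction_on' with
  | mem_mul_mem m hm n hn =>
    exact ⟨Unit, inferInstance, fun _ => m, fun _ => n, fun _ => hm, fun _ => hn, by simp⟩
  | add u _ v _ hu hv =>
    obtain ⟨ι, _, x, y, hx, hy, rfl⟩ := hu
    obtain ⟨κ, _, x', y', hx', hy', rfl⟩ := hv
    refine ⟨ι ⊕ κ, inferInstance, Sum.elim x x', Sum.elim y y', ?_, ?_, by simp⟩
    · rintro (i | i)
      exacts [hx i, hx' i]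
    · rintro (i | i)
      exacts [hy i, hy' i]

theorem Subring.mem_one_submodule {A : Subring B} {z : B} :
    z ∈ (1 : Submodule A B) ↔ z ∈ A := by
  rw [Submodule.mem_one]
  exact ⟨fun ⟨a, ha⟩ => ha ▸ a.2, fun hz => ⟨⟨z, hz⟩, rfl⟩⟩

theorem IsInvertiblePair.span_mul_span {A : Subring B} {ι : Type} [Fintype ι] {x y : ι → B}
    (h : IsInvertiblePair A x y) :
    Submodule.span A (Set.range x) * Submodule.span A (Set.range y) = 1 := by
  apply le_antisymm
  · rw [Submodule.span_mul_span, Submodule.span_le]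
    rintro _ ⟨_, ⟨i, rfl⟩, _, ⟨j, rfl⟩, rfl⟩
    exact Subring.mem_one_submodule.2 (h.mul_mem i j)
  · rw [Submodule.one_le, ← h.sum_mul_eq_one]
    exact sum_mem fun i _ => Submodule.mul_mem_mul (Submodule.subset_span ⟨i, rfl⟩)
      (Submodule.subset_span ⟨i, rfl⟩)

variable {A C : Subring B}

/-- A submodule of `C` over `A`, viewed as an `A`-submodule of `B`. -/
def Subring.submoduleInclusion (hAC : A ≤ C) :
    Submodule (A.comap C.subtype) C →* Submodule A B where
  toFun I :=
    { carrier := Subtype.val '' (I : Set C)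
      zero_mem' := ⟨0, I.zero_mem, rfl⟩
      add_mem' := by
        rintro _ _ ⟨u, hu, rfl⟩ ⟨v, hv, rfl⟩
        exact ⟨u + v, I.add_mem hu hv, rfl⟩
      smul_mem' := by
        rintro a _ ⟨u, hu, rfl⟩
        exact ⟨_, I.smul_mem (⟨⟨a, hAC a.2⟩, a.2⟩ : A.comap C.subtype) hu, rfl⟩ }
  map_one' := by
    ext z
    rw [Subring.mem_one_submodule]
    constructor
    · rintro ⟨u, hu, rfl⟩
      exact Subring.mem_one_submodule (A := A.comap C.subtype).1 hu
    · exact fun hz => ⟨⟨z, hAC hz⟩, Subring.mem_one_submodule.2 hz, rfl⟩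
  map_mul' I J := by
    apply le_antisymm
    · rintro _ ⟨u, hu, rfl⟩
      induction hu using Submodule.mul_induction_on' with
      | mem_mul_mem m hm n hn => exact Submodule.mul_mem_mul ⟨m, hm, rfl⟩ ⟨n, hn, rfl⟩
      | add u _ v _ hu hv => exact add_mem hu hv
    · rw [Submodule.mul_le]
      rintro _ ⟨m, hm, rfl⟩ _ ⟨n, hn, rfl⟩
      exact ⟨m * n, Submodule.mul_mem_mul hm hn, rfl⟩

/-- The `C`-submodule of `B` generated by an `A`-submodule, as a monoid homomorphism. -/
def Subring.submoduleExtension (hAC : A ≤ C) : Submodule A B →* Submodule C B where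
  toFun I := Submodule.span C (I : Set B)
  map_one' := by
    apply le_antisymm
    · exact Submodule.span_le.2 fun z hz =>
        Subring.mem_one_submodule.2 (hAC (Subring.mem_one_submodule.1 hz))
    · exact Submodule.one_le.2 (Submodule.subset_span (Subring.mem_one_submodule.2 A.one_mem))
  map_mul' _ _ := by
    apply le_antisymm
    · rw [Submodule.span_le]
      intro z hz
      induction hz using Submodule.mul_induction_on' with
      | mem_mul_mem m hm n hn =>
        exact Submodule.mul_mem_mul (Submodule.subset_span hm) (Submodule.subset_span hn)
      | add u _ v _ hu hv => exact add_mem hu hv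
    · rw [Submodule.span_mul_span, Submodule.span_le]
      rintro _ ⟨m, hm, n, hn, rfl⟩
      exact Submodule.subset_span (Submodule.mul_mem_mul hm hn)

theorem Subring.submoduleInclusion_injective (hAC : A ≤ C) :
    Function.Injective (Subring.submoduleInclusion hAC) := fun _ _ h =>
  SetLike.coe_injective (Subtype.val_injective.image_injective (congrArg SetLike.coe h))

theorem Subring.exists_submoduleInclusion_eq (hAC : A ≤ C) {I : Submodule A B}
    (hI : ∀ z ∈ I, z ∈ C) : ∃ I', Subring.submoduleInclusion hAC I' = I := by
  refine ⟨{ carrier := Subtype.val ⁻¹' (I : Set B)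
            zero_mem' := I.zero_mem
            add_mem' := fun hu hv => I.add_mem hu hv
            smul_mem' := fun a u hu => I.smul_mem (⟨a.1.1, a.2⟩ : A) hu }, ?_⟩
  ext z
  constructor
  · rintro ⟨u, hu, rfl⟩
    exact hu
  · exact fun hz => ⟨⟨z, hI z hz⟩, hz, rfl⟩

theorem Subring.range_submoduleInclusion_eq_ker (hAC : A ≤ C) :
    (Units.map (Subring.submoduleInclusion hAC)).range =
      (Units.map (Subring.submoduleExtension hAC)).ker := by
  ext I
  rw [MonoidHom.mem_ker]
  constructor
  · have hle : ∀ K : Submodule (A.comap C.subtype) C,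
        Subring.submoduleExtension hAC (Subring.submoduleInclusion hAC K) ≤ 1 := fun K => by
      refine Submodule.span_le.2 ?_
      rintro _ ⟨u, -, rfl⟩
      exact Subring.mem_one_submodule.2 u.2
    rintro ⟨K, rfl⟩
    ext1
    refine le_antisymm (hle _) ?_
    calc (1 : Submodule C B)
        = Subring.submoduleExtension hAC (Subring.submoduleInclusion hAC (K.1 * K.2)) := by
          rw [K.3, map_one, map_one]
      _ = Subring.submoduleExtension hAC (Subring.submoduleInclusion hAC K.1) *
          Subring.submoduleExtension hAC (Subring.submoduleInclusion hAC K.2) := by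
          rw [map_mul, map_mul]
      _ ≤ Subring.submoduleExtension hAC (Subring.submoduleInclusion hAC K.1) * 1 :=
          mul_le_mul_right (hle _) _
      _ = _ := mul_one _
  · intro hI
    have hmem : ∀ L : (Submodule A B)ˣ, Units.map (Subring.submoduleExtension hAC) L = 1 →
        ∀ z ∈ (L : Submodule A B), z ∈ C := fun L hL z hz => by
      have h1 : Submodule.span C ((L : Submodule A B) : Set B) = 1 := congrArg Units.val hL
      rw [← Subring.mem_one_submodule, ← h1]
      exact Submodule.subset_span hz
    obtain ⟨K, hK⟩ := Subring.exists_submoduleInclusion_eq hAC (hmem I hI)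
    obtain ⟨K', hK'⟩ := Subring.exists_submoduleInclusion_eq hAC
      (hmem I⁻¹ (by rw [map_inv, hI, inv_one]))
    have hKK' : K * K' = 1 := by
      apply Subring.submoduleInclusion_injective hAC
      rw [map_mul, hK, hK', map_one, Units.mul_inv]
    exact ⟨⟨K, K', hKK', by rw [mul_comm, hKK']⟩, Units.ext hK⟩

theorem Subring.submoduleExtension_units_surjective (hAC : A ≤ C)
    (hC : C ≤ A.subintegralClosureIn C) :
    Function.Surjective (Units.map (Subring.submoduleExtension hAC)) := by
  intro J
  have h1 : (1 : B) ∈ J.1 * J.2 := by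
    rw [J.3]
    exact Subring.mem_one_submodule.2 C.one_mem
  obtain ⟨ι, _, x, y, hx, hy, hxy⟩ := Submodule.exists_fintype_sum_of_mem_mul h1
  obtain ⟨T, hT, hmem⟩ := Subring.IsElementaryTower.exists_forall_mem
    (f := fun p : ι × ι => x p.1 * y p.2) (A := A) (D := C) fun p => by
      refine hC (Subring.mem_one_submodule.1 ?_)
      rw [← J.3]
      exact Submodule.mul_mem_mul (hx p.1) (hy p.2)
  obtain ⟨κ, _, x', y', h', hx', hy'⟩ :=
    hT.exists_descent hAC (⟨hxy, fun i j => hmem (i, j)⟩ : IsInvertiblePair T x y)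
  set I := Submodule.span A (Set.range x')
  set I' := Submodule.span A (Set.range y')
  have hII' : I * I' = 1 := h'.span_mul_span
  have span_le : ∀ {l : Type} {v : l → B} {N : Submodule C B}, (∀ k, v k ∈ N) →
      Subring.submoduleExtension hAC (Submodule.span A (Set.range v)) ≤ N := by
    intro l v N hv
    refine Submodule.span_le.2 fun z hz => ?_
    induction hz using Submodule.span_induction with
    | mem z hz =>
      obtain ⟨k, rfl⟩ := hz
      exact hv k
    | zero => exact N.zero_mem
    | add _ _ _ _ hu hv => exact N.add_mem hu hv
    | smul a _ _ hu => exact N.smul_mem (⟨a, hAC a.2⟩ : C) hu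
  have hIJ : Subring.submoduleExtension hAC I ≤ J.1 :=
    span_le fun k => Submodule.span_le.2 (Set.range_subset_iff.2 hx) (hx' k)
  have hIJ' : Subring.submoduleExtension hAC I' ≤ J.2 :=
    span_le fun k => Submodule.span_le.2 (Set.range_subset_iff.2 hy) (hy' k)
  refine ⟨⟨I, I', hII', by rw [mul_comm, hII']⟩, Units.ext (le_antisymm hIJ ?_)⟩
  calc J.1 = J.1 * Subring.submoduleExtension hAC (I' * I) := by
        rw [mul_comm I', hII', map_one, mul_one]
    _ = J.1 * Subring.submoduleExtension hAC I' * Subring.submoduleExtension hAC I := by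
        rw [map_mul, mul_assoc]
    _ ≤ J.1 * J.2 * Subring.submoduleExtension hAC I :=
        mul_le_mul_left (mul_le_mul_right hIJ' _) _
    _ = Subring.submoduleExtension hAC I := by rw [J.3, one_mul]

/-- The exact sequence of groups of invertible submodules attached to `A ⊆ C ⊆ B` with `C`
subintegral over `A`. -/
theorem Subring.exact_sequence_units_submodule (hAC : A ≤ C) (hC : C ≤ A.subintegralClosureIn C) :
    ∃ (f₁ : (Submodule (A.comap C.subtype) C)ˣ →* (Submodule A B)ˣ)
      (f₂ : (Submodule A B)ˣ →* (Submodule C B)ˣ),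
      (∀ I, ((f₁ I : Submodule A B) : Set B) =
          Subtype.val '' ((I : Submodule (A.comap C.subtype) C) : Set C)) ∧
      (∀ I, (f₂ I : Submodule C B) = Submodule.span C ((I : Submodule A B) : Set B)) ∧
      Function.Injective f₁ ∧ f₁.range = f₂.ker ∧ Function.Surjective f₂ :=
  ⟨Units.map (Subring.submoduleInclusion hAC), Units.map (Subring.submoduleExtension hAC),
    fun _ => rfl, fun _ => rfl,
    Units.map_injective (Subring.submoduleInclusion_injective hAC),
    Subring.range_submoduleInclusion_eq_ker hAC,
    Subring.submoduleExtension_units_surjective hAC hC⟩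

end InvertibleSubmodules

section SubintegralClosure

variable {B : Type*} [CommRing B] (A : Subring B)

theorem Subring.le_subintegralClosure : A ≤ A.subintegralClosure :=
  le_sInf fun _ hT => hT.1

theorem Subring.isSubintegrallyClosedIn_subintegralClosure :
    A.subintegralClosure.IsSubintegrallyClosedIn := fun b h2 h3 =>
  Subring.mem_sInf.2 fun T hT =>
    hT.2 b trivial (Subring.mem_sInf.1 h2 T hT) (Subring.mem_sInf.1 h3 T hT)

theorem Subring.subintegralClosure_le_subintegralClosureIn_self :
    A.subintegralClosure ≤ A.subintegralClosureIn A.subintegralClosure :=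
  le_sInf fun T hT => by
    have : A.subintegralClosure ≤ T ⊓ A.subintegralClosure := by
      refine sInf_le ⟨le_inf hT.1 A.le_subintegralClosure, fun b _ h2 h3 => ?_⟩
      have hb := A.isSubintegrallyClosedIn_subintegralClosure b h2.2 h3.2
      exact ⟨hT.2 b hb h2.1 h3.1, hb⟩
    exact this.trans inf_le_left

theorem monoidAlgebraSubring_mono {N : Type*} [CommMonoid N] {A C : Subring B} (hAC : A ≤ C)
    (M : Submonoid N) : monoidAlgebraSubring A M ≤ monoidAlgebraSubring C M :=
  Subring.closure_mono fun _ ⟨a, ha, m, hm, hx⟩ => ⟨a, hAC ha, m, hm, hx⟩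

theorem single_mem_monoidAlgebraSubring {N : Type*} [CommMonoid N] {A : Subring B}
    {M : Submonoid N} {a : B} (ha : a ∈ A) {m : N} (hm : m ∈ M) :
    MonoidAlgebra.single m a ∈ monoidAlgebraSubring A M :=
  Subring.subset_closure ⟨a, ha, m, hm, rfl⟩

theorem monoidAlgebraSubring_le_subintegralClosureIn {N : Type*} [CommMonoid N]
    {A C : Subring B} (hC : C ≤ A.subintegralClosureIn C) (M : Submonoid N) :
    monoidAlgebraSubring C M ≤
      (monoidAlgebraSubring A M).subintegralClosureIn (monoidAlgebraSubring C M) := by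
  refine le_sInf fun T hT => Subring.closure_le.2 ?_
  rintro _ ⟨c, hc, m, hm, rfl⟩
  have hCT : C ≤ T.comap (MonoidAlgebra.singleOneRingHom (R := B) (M := N)) := by
    refine hC.trans (sInf_le ⟨fun a ha => hT.1 (single_mem_monoidAlgebraSubring ha M.one_mem), ?_⟩)
    intro b hb h2 h3
    rw [Subring.mem_comap, map_pow] at h2 h3
    exact hT.2 _ (single_mem_monoidAlgebraSubring hb M.one_mem) h2 h3
  have h := T.mul_mem (hCT hc) (hT.1 (single_mem_monoidAlgebraSubring A.one_mem hm))
  simpa [MonoidAlgebra.single_mul_single] using h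

end SubintegralClosure

/-- **Sarwar, Theorem 1.4(i).**  Let `A ⊆ B` be an extension of commutative rings, `⁺A` the
subintegral closure of `A` in `B`, and `M` a positive commutative cancellative torsion-free
monoid.  Then both sequences
`1 → 𝓘(A,⁺A) → 𝓘(A,B) → 𝓘(⁺A,B) → 1` and
`1 → 𝓘(A[M],(⁺A)[M]) → 𝓘(A[M],B[M]) → 𝓘((⁺A)[M],B[M]) → 1`
are exact, where the first map of each sequence views an invertible submodule inside the
larger ring and the second sends `I` to the submodule generated by `I` over the larger
subring. -/
theorem exact_sequences_of_invertible_submodules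
    {B : Type*} [CommRing B] (A : Subring B)
    {M : Type*} [CancelCommMonoid M]
    (htf : MulTorsionFree M) (hpos : IsPositiveMonoid M) :
    (∃ (f₁ : (Submodule (A.comap (A.subintegralClosure).subtype) (A.subintegralClosure))ˣ →*
          (Submodule A B)ˣ)
       (f₂ : (Submodule A B)ˣ →* (Submodule (A.subintegralClosure) B)ˣ),
      (∀ I, ((f₁ I : Submodule A B) : Set B) =
          Subtype.val ''
            ((I : Submodule (A.comap (A.subintegralClosure).subtype) (A.subintegralClosure)) :
              Set (A.subintegralClosure))) ∧
      (∀ I, (f₂ I : Submodule (A.subintegralClosure) B) =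
          Submodule.span (A.subintegralClosure) ((I : Submodule A B) : Set B)) ∧
      Function.Injective f₁ ∧ f₁.range = f₂.ker ∧ Function.Surjective f₂) ∧
    (∃ (g₁ : (Submodule
            ((monoidAlgebraSubring A (⊤ : Submonoid M)).comap
              (monoidAlgebraSubring (A.subintegralClosure) (⊤ : Submonoid M)).subtype)
            (monoidAlgebraSubring (A.subintegralClosure) (⊤ : Submonoid M)))ˣ →*
          (Submodule (monoidAlgebraSubring A (⊤ : Submonoid M)) (MonoidAlgebra B M))ˣ)
       (g₂ : (Submodule (monoidAlgebraSubring A (⊤ : Submonoid M)) (MonoidAlgebra B M))ˣ →*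
          (Submodule (monoidAlgebraSubring (A.subintegralClosure) (⊤ : Submonoid M))
            (MonoidAlgebra B M))ˣ),
      (∀ I, ((g₁ I : Submodule (monoidAlgebraSubring A (⊤ : Submonoid M)) (MonoidAlgebra B M)) :
            Set (MonoidAlgebra B M)) =
          Subtype.val ''
            ((I : Submodule
                ((monoidAlgebraSubring A (⊤ : Submonoid M)).comap
                  (monoidAlgebraSubring (A.subintegralClosure) (⊤ : Submonoid M)).subtype)
                (monoidAlgebraSubring (A.subintegralClosure) (⊤ : Submonoid M))) :
              Set (monoidAlgebraSubring (A.subintegralClosure) (⊤ : Submonoid M)))) ∧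
      (∀ I, (g₂ I : Submodule (monoidAlgebraSubring (A.subintegralClosure) (⊤ : Submonoid M))
            (MonoidAlgebra B M)) =
          Submodule.span (monoidAlgebraSubring (A.subintegralClosure) (⊤ : Submonoid M))
            ((I : Submodule (monoidAlgebraSubring A (⊤ : Submonoid M)) (MonoidAlgebra B M)) :
              Set (MonoidAlgebra B M))) ∧
      Function.Injective g₁ ∧ g₁.range = g₂.ker ∧ Function.Surjective g₂) := by
  have h := A.subintegralClosure_le_subintegralClosureIn_self
  exact ⟨Subring.exact_sequence_units_submodule A.le_subintegralClosure h,
    Subring.exact_sequence_units_submodule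
      (monoidAlgebraSubring_mono A.le_subintegralClosure ⊤)
      (monoidAlgebraSubring_le_subintegralClosureIn h ⊤)⟩
end
end
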